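/- Consider transmission of a Reed–Muller codeword over BSC(δ): U uniform on F₂^{2^m}, X = G U with G = [[1,0],[1,1]]^{⊗m}, Y = X + Z with Z a vector of i.i.d. Bernoulli(δ) bits independent of U; coefficients U are indexed by binary strings of length m, with U_{≤r} the coefficients of index weight ≤ r and U_{>r} those of weight > r. If limsup_{m→∞} binom(m,≤r_m)/2^m < 1 − H(δ), then there exist constants c, c' > 0 such that for all sufficiently large m: with probability at least 1 − 2^{−c'√m} over the realization (u, y) of (U, Y), the conditional probability of the true value satisfies P( U_{≤r_m} = u_{≤r_m} | U_{>r_m} = u_{>r_m}, Y = y ) ≥ 2^{−2^{m − c√m}}; consequently, the true codeword lies among the 2^{2^{m−c√m}} most likely candidates given (Y, U_{>r_m}) with probability at least 1 − 2^{−c'√m}. -/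

import Mathlib

open MeasureTheory

/-- Index set: binary strings of length `m` (indexing both coordinates and monomials). -/
abbrev Idx (m : ℕ) := Fin m → ZMod 2

/-- Hamming weight of a binary string. -/
def wt {m : ℕ} (x : Idx m) : ℕ := (Finset.univ.filter (fun i => x i = 1)).card

/-- The 2×2 base matrix `[[1,0],[1,1]]` (rows/columns indexed by `F₂`):
entry `(a,b)` is `0` iff `a = 0` and `b = 1`. -/
def base : ZMod 2 → ZMod 2 → ZMod 2 := fun a b => if a = 0 ∧ b = 1 then 0 else 1

/-- The `m`-fold Kronecker power `G = [[1,0],[1,1]]^{⊗ m}`, as a matrix indexed by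
binary strings of length `m`. -/
def Gmat (m : ℕ) : Matrix (Idx m) (Idx m) (ZMod 2) := fun x y => ∏ i, base (x i) (y i)

/-- The Bernoulli(δ) measure on `F₂` (probability `δ` of `1`). -/
noncomputable def bern2 (δ : ℝ) : Measure (ZMod 2) :=
  ENNReal.ofReal δ • Measure.dirac 1 + ENNReal.ofReal (1 - δ) • Measure.dirac 0

/-- The law of the i.i.d. Bernoulli(δ) noise vector `Z = (Z_x)_{x ∈ F₂^m}`. -/
noncomputable def noise (m : ℕ) (δ : ℝ) : Measure (Idx m → ZMod 2) :=
  Measure.pi (fun _ => bern2 δ)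

/-- The transformed noise vector `W = G Z`. -/
def Wfun (m : ℕ) (z : Idx m → ZMod 2) : Idx m → ZMod 2 := (Gmat m).mulVec z

/-- `W_r`: the coordinates of `W` whose index has Hamming weight exactly `r`. -/
def Wr (m r : ℕ) (z : Idx m → ZMod 2) : {x : Idx m // wt x = r} → ZMod 2 :=
  fun x => Wfun m z x.val

/-- `W_{>r}`: the coordinates of `W` whose index has Hamming weight `> r`. -/
def Wgt (m r : ℕ) (z : Idx m → ZMod 2) : {x : Idx m // r < wt x} → ZMod 2 :=
  fun x => Wfun m z x.val

/-- `W_{≤r}`: the coordinates of `W` whose index has Hamming weight `≤ r`. -/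
def Wle (m r : ℕ) (z : Idx m → ZMod 2) : {x : Idx m // wt x ≤ r} → ZMod 2 :=
  fun x => Wfun m z x.val

/-- Base-2 Shannon entropy of a random variable `X` (with finitely many values)
on the probability space `(Ω, μ)`: `H(X) = -∑ₛ P(X = s) log₂ P(X = s)`. -/
noncomputable def ent {Ω S : Type*} [MeasurableSpace Ω] (μ : Measure Ω) (X : Ω → S) : ℝ :=
  -∑' s : S, (μ (X ⁻¹' {s})).toReal * Real.logb 2 (μ (X ⁻¹' {s})).toReal

/-- Conditional entropy `H(X|Y) = H(X,Y) - H(Y)`. -/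
noncomputable def condEnt {Ω S T : Type*} [MeasurableSpace Ω] (μ : Measure Ω)
    (X : Ω → S) (Y : Ω → T) : ℝ :=
  ent μ (fun ω => (X ω, Y ω)) - ent μ Y

/-- The binary entropy function `H(δ) = -δ log₂ δ - (1-δ) log₂ (1-δ)`. -/
noncomputable def Hbin (δ : ℝ) : ℝ :=
  -(δ * Real.logb 2 δ) - (1 - δ) * Real.logb 2 (1 - δ)

/-- `binom(m, ≤ r) = ∑_{i=0}^{r} binom(m,i)`. -/
def binomLe (m r : ℕ) : ℕ := ∑ i ∈ Finset.range (r + 1), m.choose i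

/-- The uniform probability measure on a (finite, nonempty) type: normalized counting measure. -/
noncomputable def unifM (α : Type*) [MeasurableSpace α] : Measure α :=
  (Measure.count (Set.univ : Set α))⁻¹ • Measure.count

/-- The joint law of `(U, Z)`: `U` uniform on `F₂^{2^m}` (coefficients), `Z` the
i.i.d. Bernoulli(δ) noise, independent. -/
noncomputable def μUZ (m : ℕ) (δ : ℝ) : Measure ((Idx m → ZMod 2) × (Idx m → ZMod 2)) :=
  (unifM (Idx m → ZMod 2)).prod (noise m δ)

/-- The received noisy codeword `Y = G U + Z`. -/
def Yf (m : ℕ) (p : (Idx m → ZMod 2) × (Idx m → ZMod 2)) : Idx m → ZMod 2 :=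
  (Gmat m).mulVec p.1 + p.2

/-- `U_{≤ r}`: the coefficients of index weight `≤ r`. -/
def Ule (m r : ℕ) (p : (Idx m → ZMod 2) × (Idx m → ZMod 2)) :
    {x : Idx m // wt x ≤ r} → ZMod 2 := fun x => p.1 x.val

/-- `U_{> r}`: the coefficients of index weight `> r`. -/
def Ugt (m r : ℕ) (p : (Idx m → ZMod 2) × (Idx m → ZMod 2)) :
    {x : Idx m // r < wt x} → ZMod 2 := fun x => p.1 x.val

/-- The conditional probability `P(U_{≤r} = a | U_{>r} = u_{>r}, Y = y)` evaluated at
the data `(u_{>r}, y)` coming from the sample `p₀`. -/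
noncomputable def condPa (m r : ℕ) (δ : ℝ) (a : {x : Idx m // wt x ≤ r} → ZMod 2)
    (p₀ : (Idx m → ZMod 2) × (Idx m → ZMod 2)) : ENNReal :=
  μUZ m δ {p | Ule m r p = a ∧ Ugt m r p = Ugt m r p₀ ∧ Yf m p = Yf m p₀}
    / μUZ m δ {p | Ugt m r p = Ugt m r p₀ ∧ Yf m p = Yf m p₀}

/-- The conditional probability of the true value,
`P(U_{≤r} = u_{≤r} | U_{>r} = u_{>r}, Y = y)` at the sample `p₀ = (u, z)`. -/
noncomputable def condP (m r : ℕ) (δ : ℝ)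
    (p₀ : (Idx m → ZMod 2) × (Idx m → ZMod 2)) : ENNReal :=
  condPa m r δ (Ule m r p₀) p₀

section NoiseWeights

/-- Probability mass of a Bernoulli(δ) bit. -/
def bitWeight (δ : ℝ) (a : ZMod 2) : ℝ := if a = 1 then δ else 1 - δ

/-- Probability mass of a vector of i.i.d. Bernoulli(δ) bits. -/
def noiseWeight {ι : Type*} [Fintype ι] (δ : ℝ) (z : ι → ZMod 2) : ℝ := ∏ v, bitWeight δ (z v)

/-- The normalized (mean zero, variance one) Bernoulli(δ) bit. -/
noncomputable def biasedChar (δ : ℝ) (a : ZMod 2) : ℝ :=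
  if a = 1 then -(1 - δ) / √(δ * (1 - δ)) else δ / √(δ * (1 - δ))

/-- The orthonormal Fourier basis of the δ-biased cube. -/
noncomputable def biasedWalsh {ι : Type*} (δ : ℝ) (S : Finset ι) (z : ι → ZMod 2) : ℝ :=
  ∏ v ∈ S, biasedChar δ (z v)

theorem zmod_two_eq_zero_or_one : ∀ a : ZMod 2, a = 0 ∨ a = 1 := by decide

theorem sum_zmod_two {M : Type*} [AddCommMonoid M] (f : ZMod 2 → M) : ∑ a, f a = f 0 + f 1 :=
  Fin.sum_univ_two f

theorem bitWeight_pos {δ : ℝ} (hδ : δ ∈ Set.Ioo (0 : ℝ) 1) (a : ZMod 2) : 0 < bitWeight δ a := by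
  unfold bitWeight
  split_ifs
  · exact hδ.1
  · linarith [hδ.2]

theorem noiseWeight_pos {ι : Type*} [Fintype ι] {δ : ℝ} (hδ : δ ∈ Set.Ioo (0 : ℝ) 1)
    (z : ι → ZMod 2) : 0 < noiseWeight δ z :=
  Finset.prod_pos fun v _ => bitWeight_pos hδ (z v)

theorem biasedWalsh_comp {ι κ : Type*} [DecidableEq κ] {δ : ℝ} {A : ι → κ}
    (hA : Function.Injective A) (S : Finset ι)
    (z : κ → ZMod 2) : biasedWalsh δ S (z ∘ A) = biasedWalsh δ (S.image A) z := by
  simp [biasedWalsh, Finset.prod_image hA.injOn]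

variable {ι κ : Type*} [Fintype ι] [Fintype κ] [DecidableEq ι] [DecidableEq κ] {δ : ℝ}

theorem sum_noiseWeight_mul_prod (δ : ℝ) (g : ι → ZMod 2 → ℝ) :
    ∑ z : ι → ZMod 2, noiseWeight δ z * ∏ v, g v (z v) = ∏ v, ∑ a, bitWeight δ a * g v a := by
  rw [Fintype.prod_sum]
  simp only [noiseWeight, Finset.prod_mul_distrib]

theorem sum_bitWeight (δ : ℝ) : ∑ a, bitWeight δ a = 1 := by
  simp [sum_zmod_two, bitWeight]

theorem sum_noiseWeight (δ : ℝ) : ∑ z : ι → ZMod 2, noiseWeight δ z = 1 := by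
  simpa [sum_bitWeight] using sum_noiseWeight_mul_prod (ι := ι) δ fun _ _ => 1

theorem sum_noiseWeight_mul_apply (δ : ℝ) (g : ZMod 2 → ℝ) (v : ι) :
    ∑ z : ι → ZMod 2, noiseWeight δ z * g (z v) = ∑ a, bitWeight δ a * g a := by
  have h := sum_noiseWeight_mul_prod (ι := ι) δ fun u a => if u = v then g a else 1
  have hr : ∀ u, (∑ a, bitWeight δ a * (if u = v then g a else 1))
      = if u = v then ∑ a, bitWeight δ a * g a else 1 := by
    intro u
    split_ifs <;> simp [sum_bitWeight]
  simpa only [hr, Finset.prod_ite_eq', Finset.mem_univ, if_true] using h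

theorem sum_bitWeight_mul_biasedChar (δ : ℝ) : ∑ a, bitWeight δ a * biasedChar δ a = 0 := by
  simp [sum_zmod_two, bitWeight, biasedChar]
  ring

theorem sum_bitWeight_mul_biasedChar_sq (hδ : δ ∈ Set.Ioo (0 : ℝ) 1) :
    ∑ a, bitWeight δ a * (biasedChar δ a * biasedChar δ a) = 1 := by
  have h0 : 0 < δ * (1 - δ) := mul_pos hδ.1 (by linarith [hδ.2])
  have hs := Real.mul_self_sqrt h0.le
  have hs0 : √(δ * (1 - δ)) ≠ 0 := (Real.sqrt_pos.2 h0).ne'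
  simp only [sum_zmod_two, bitWeight, biasedChar]
  simp only [zero_ne_one, if_true, if_false, div_mul_div_comm, hs]
  field_simp [h0.ne', hδ.1.ne', (by linarith [hδ.2] : (1 - δ) ≠ 0)]
  ring

theorem sum_noiseWeight_mul_biasedWalsh_mul (hδ : δ ∈ Set.Ioo (0 : ℝ) 1) (S T : Finset ι) :
    ∑ z, noiseWeight δ z * (biasedWalsh δ S z * biasedWalsh δ T z) = if S = T then 1 else 0 := by
  have h := sum_noiseWeight_mul_prod (ι := ι) δ fun v a =>
    (if v ∈ S then biasedChar δ a else 1) * (if v ∈ T then biasedChar δ a else 1)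
  have hprod : ∀ (R : Finset ι) (z : ι → ZMod 2),
      biasedWalsh δ R z = ∏ v, if v ∈ R then biasedChar δ (z v) else 1 := by
    intro R z
    simp [biasedWalsh, Finset.prod_ite_mem]
  simp only [Finset.prod_mul_distrib] at h
  simp only [hprod, h]
  split_ifs with hST
  · subst hST
    refine Finset.prod_eq_one fun v _ => ?_
    by_cases hv : v ∈ S <;> simp [hv, sum_bitWeight, sum_bitWeight_mul_biasedChar_sq hδ]
  · obtain ⟨v, hv⟩ : ∃ v, ¬(v ∈ S ↔ v ∈ T) := by
      by_contra! hcon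
      exact hST (Finset.ext hcon)
    refine Finset.prod_eq_zero (Finset.mem_univ v) ?_
    by_cases h1 : v ∈ S <;> by_cases h2 : v ∈ T <;>
      simp_all [sum_bitWeight_mul_biasedChar]

theorem exists_biasedWalsh_expansion (hδ : δ ∈ Set.Ioo (0 : ℝ) 1) (f : (ι → ZMod 2) → ℝ) :
    ∃ a : Finset ι → ℝ, ∀ z, f z = ∑ S, a S * biasedWalsh δ S z := by
  have h0 : 0 < δ * (1 - δ) := mul_pos hδ.1 (by linarith [hδ.2])
  have hs0 : √(δ * (1 - δ)) ≠ 0 := (Real.sqrt_pos.2 h0).ne'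
  obtain ⟨α, β, hαβ⟩ : ∃ α β : ZMod 2 → ℝ, ∀ b a : ZMod 2,
      (if a = b then (1 : ℝ) else 0) = α b * biasedChar δ a + β b := by
    refine ⟨fun b => if b = 1 then -√(δ * (1 - δ)) else √(δ * (1 - δ)),
      fun b => if b = 1 then δ else 1 - δ, fun b a => ?_⟩
    rcases zmod_two_eq_zero_or_one a with rfl | rfl <;>
      rcases zmod_two_eq_zero_or_one b with rfl | rfl <;>
      simp [biasedChar] <;> field_simp <;> ring
  refine ⟨fun S => ∑ y, f y * ((∏ v ∈ S, α (y v)) * ∏ v ∈ Sᶜ, β (y v)), fun z => ?_⟩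
  have hpt : ∀ y, (if z = y then (1 : ℝ) else 0)
      = ∑ S, ((∏ v ∈ S, α (y v)) * ∏ v ∈ Sᶜ, β (y v)) * biasedWalsh δ S z := by
    intro y
    have : (if z = y then (1 : ℝ) else 0) = ∏ v, if z v = y v then (1 : ℝ) else 0 := by
      simp [funext_iff, Finset.prod_ite_zero]
    rw [this]
    simp only [hαβ, Fintype.prod_add, Finset.prod_mul_distrib, biasedWalsh]
    exact Finset.sum_congr rfl fun S _ => by ring
  calc f z = ∑ y, f y * (if z = y then (1 : ℝ) else 0) := by simp
    _ = _ := by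
      simp only [hpt, Finset.mul_sum, Finset.sum_mul]
      rw [Finset.sum_comm]
      exact Finset.sum_congr rfl fun _ _ => Finset.sum_congr rfl fun _ _ => by ring

theorem sum_noiseWeight_mul_biasedWalsh (hδ : δ ∈ Set.Ioo (0 : ℝ) 1) (S : Finset ι) :
    ∑ z, noiseWeight δ z * biasedWalsh δ S z = if S = ∅ then 1 else 0 := by
  simpa [biasedWalsh] using sum_noiseWeight_mul_biasedWalsh_mul hδ S ∅

/-- The law of the noise vector is compatible with restriction to a subset of coordinates. -/
theorem sum_noiseWeight_comp (hδ : δ ∈ Set.Ioo (0 : ℝ) 1) {A : ι → κ}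
    (hA : Function.Injective A) (f : (ι → ZMod 2) → ℝ) :
    ∑ z, noiseWeight δ z * f (z ∘ A) = ∑ z, noiseWeight δ z * f z := by
  obtain ⟨a, ha⟩ := exists_biasedWalsh_expansion hδ f
  simp only [ha, biasedWalsh_comp hA, Finset.mul_sum]
  rw [Finset.sum_comm, Finset.sum_comm (s := (Finset.univ : Finset (ι → ZMod 2)))]
  refine Finset.sum_congr rfl fun S _ => ?_
  simp only [mul_left_comm _ (a S), ← Finset.mul_sum, sum_noiseWeight_mul_biasedWalsh hδ,
    Finset.image_eq_empty]

/-- Averaging a bounded function over a family of embeddings of the coordinate set, each target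
coordinate being hit by at most a fraction `ρ` of the embeddings, gives variance at most `ρ`. -/
theorem variance_average_le (hδ : δ ∈ Set.Ioo (0 : ℝ) 1) {J : Type*} [Fintype J] [Nonempty J]
    {A : J → ι → κ} (hA : ∀ j, Function.Injective (A j)) {ρ : ℝ}
    (hρ : ∀ v, (((Finset.univ.filter fun j => v ∈ Set.range (A j)).card : ℕ) : ℝ)
      ≤ ρ * Fintype.card J)
    {f : (ι → ZMod 2) → ℝ} (hf : ∀ z, |f z| ≤ 1) (hρ0 : 0 ≤ ρ) :
    ∑ z, noiseWeight δ z * ((Fintype.card J : ℝ)⁻¹ * ∑ j, f (z ∘ A j)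
      - ∑ y, noiseWeight δ y * f y) ^ 2 ≤ ρ := by
  classical
  obtain ⟨a, ha⟩ := exists_biasedWalsh_expansion hδ f
  set N : ℝ := (Fintype.card J : ℝ) with hN
  have hNpos : 0 < N := by rw [hN]; exact_mod_cast Fintype.card_pos
  have hmean : ∑ y, noiseWeight δ y * f y = a ∅ := by
    simp only [ha, Finset.mul_sum]
    rw [Finset.sum_comm]
    simp only [mul_left_comm _ (a _), ← Finset.mul_sum, sum_noiseWeight_mul_biasedWalsh hδ]
    simp
  have hsq : ∑ S, a S ^ 2 ≤ 1 := by
    have h1 : ∑ z, noiseWeight δ z * (f z * f z) = ∑ S, a S ^ 2 := by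
      simp only [ha, Finset.mul_sum, Finset.sum_mul]
      rw [Finset.sum_comm]
      refine Finset.sum_congr rfl fun S _ => ?_
      rw [Finset.sum_comm]
      rw [Finset.sum_eq_single S]
      · have := sum_noiseWeight_mul_biasedWalsh_mul hδ S S
        simp only [if_true] at this
        rw [← mul_one (a S ^ 2), ← this, Finset.mul_sum]
        exact Finset.sum_congr rfl fun _ _ => by ring
      · intro T _ hT
        have := sum_noiseWeight_mul_biasedWalsh_mul hδ S T
        rw [if_neg hT.symm] at this
        rw [← mul_zero (a S * a T), ← this, Finset.mul_sum]
        exact Finset.sum_congr rfl fun _ _ => by ring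
      · simp
    rw [← h1, ← sum_noiseWeight (ι := ι) δ]
    refine Finset.sum_le_sum fun z _ => ?_
    have : f z * f z ≤ 1 := by
      have := abs_le.1 (hf z)
      nlinarith
    nlinarith [noiseWeight_pos hδ z]
  set b : Finset ι → ℝ := fun S => if S = ∅ then 0 else a S with hb
  have hdev : ∀ z : κ → ZMod 2, N⁻¹ * ∑ j, f (z ∘ A j) - a ∅
      = N⁻¹ * ∑ p : J × Finset ι, b p.2 * biasedWalsh δ (p.2.image (A p.1)) z := by
    intro z
    have : ∀ j, f (z ∘ A j) = a ∅ + ∑ S, b S * biasedWalsh δ (S.image (A j)) z := by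
      intro j
      rw [ha, ← Finset.add_sum_erase _ _ (Finset.mem_univ ∅),
        ← Finset.add_sum_erase _ (fun S => b S * _) (Finset.mem_univ ∅)]
      simp only [hb, if_true, zero_mul, zero_add]
      congr 1
      · simp [biasedWalsh]
      · refine Finset.sum_congr rfl fun S hS => ?_
        rw [if_neg (Finset.ne_of_mem_erase hS), biasedWalsh_comp (hA j)]
    simp only [this, Finset.sum_add_distrib, Fintype.sum_prod_type]
    simp only [Finset.sum_const, Finset.card_univ, nsmul_eq_mul, ← hN]
    field_simp
    ring
  simp only [hmean, hdev]
  have hexpand : ∑ z, noiseWeight δ z *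
      (N⁻¹ * ∑ p : J × Finset ι, b p.2 * biasedWalsh δ (p.2.image (A p.1)) z) ^ 2
      = (N⁻¹) ^ 2 * ∑ p : J × Finset ι, ∑ q : J × Finset ι, b p.2 * b q.2 *
        (if p.2.image (A p.1) = q.2.image (A q.1) then 1 else 0) := by
    simp only [← sum_noiseWeight_mul_biasedWalsh_mul hδ]
    simp only [mul_pow]
    simp only [sq (∑ p : J × Finset ι, _)]
    simp only [Finset.sum_mul_sum]
    simp only [Finset.mul_sum]
    rw [Finset.sum_comm]
    refine Finset.sum_congr rfl fun p _ => ?_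
    rw [Finset.sum_comm]
    refine Finset.sum_congr rfl fun q _ => ?_
    exact Finset.sum_congr rfl fun _ _ => by ring
  rw [hexpand]
  have hcs : ∑ p : J × Finset ι, ∑ q : J × Finset ι, b p.2 * b q.2 *
        (if p.2.image (A p.1) = q.2.image (A q.1) then (1 : ℝ) else 0)
      ≤ ∑ p : J × Finset ι, ∑ q : J × Finset ι, b p.2 ^ 2 *
        (if p.2.image (A p.1) = q.2.image (A q.1) then (1 : ℝ) else 0) := by
    have hsym : ∑ p : J × Finset ι, ∑ q : J × Finset ι, b p.2 ^ 2 *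
        (if p.2.image (A p.1) = q.2.image (A q.1) then (1 : ℝ) else 0)
        = ∑ p : J × Finset ι, ∑ q : J × Finset ι, b q.2 ^ 2 *
        (if p.2.image (A p.1) = q.2.image (A q.1) then (1 : ℝ) else 0) := by
      rw [Finset.sum_comm]
      simp only [eq_comm]
    have h2 : 2 * ∑ p : J × Finset ι, ∑ q : J × Finset ι, b p.2 * b q.2 *
        (if p.2.image (A p.1) = q.2.image (A q.1) then (1 : ℝ) else 0)
        ≤ ∑ p : J × Finset ι, ∑ q : J × Finset ι, b p.2 ^ 2 *
        (if p.2.image (A p.1) = q.2.image (A q.1) then (1 : ℝ) else 0)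
        + ∑ p : J × Finset ι, ∑ q : J × Finset ι, b q.2 ^ 2 *
        (if p.2.image (A p.1) = q.2.image (A q.1) then (1 : ℝ) else 0) := by
      simp only [Finset.mul_sum, ← Finset.sum_add_distrib]
      refine Finset.sum_le_sum fun p _ => Finset.sum_le_sum fun q _ => ?_
      split_ifs <;> nlinarith [sq_nonneg (b p.2 - b q.2)]
    linarith
  have hcount : ∀ p : J × Finset ι, ∑ q : J × Finset ι, b p.2 ^ 2 *
        (if p.2.image (A p.1) = q.2.image (A q.1) then (1 : ℝ) else 0) ≤ a p.2 ^ 2 * (ρ * N) := by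
    rintro ⟨j, S⟩
    rw [← Finset.mul_sum]
    by_cases hS : S = ∅
    · simp only [hb, hS, if_true]
      have := mul_nonneg (sq_nonneg (a ∅)) (mul_nonneg hρ0 hNpos.le)
      simpa using this
    · simp only [hb, hS, if_false]
      refine mul_le_mul_of_nonneg_left ?_ (sq_nonneg _)
      obtain ⟨u, hu⟩ := Finset.nonempty_iff_ne_empty.2 hS
      refine le_trans ?_ (hρ (A j u))
      rw [Fintype.sum_prod_type, Finset.card_filter, Nat.cast_sum]
      refine Finset.sum_le_sum fun k _ => ?_
      by_cases hk : A j u ∈ Set.range (A k)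
      · simp only [hk, if_true, Finset.sum_boole]
        have : (Finset.univ.filter fun T : Finset ι => S.image (A j) = T.image (A k)).card ≤ 1 := by
          refine Finset.card_le_one.2 fun T hT T' hT' => ?_
          simp only [Finset.mem_filter, Finset.mem_univ, true_and] at hT hT'
          exact Finset.image_injective (hA k) (hT.symm.trans hT')
        exact_mod_cast this
      · simp only [hk, if_false, Nat.cast_zero]
        refine (Finset.sum_eq_zero fun T _ => if_neg fun hT => hk ?_).le
        have : A j u ∈ T.image (A k) := hT ▸ Finset.mem_image_of_mem _ hu
        obtain ⟨t, _, ht⟩ := Finset.mem_image.1 this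
        exact ⟨t, ht⟩
  calc (N⁻¹) ^ 2 * _ ≤ (N⁻¹) ^ 2 * ∑ p : J × Finset ι, a p.2 ^ 2 * (ρ * N) :=
        mul_le_mul_of_nonneg_left (hcs.trans (Finset.sum_le_sum fun p _ => hcount p))
          (by positivity)
    _ = ρ * ∑ S, a S ^ 2 := by
        simp only [Fintype.sum_prod_type, ← Finset.sum_mul, Finset.sum_const, Finset.card_univ,
          nsmul_eq_mul, ← hN]
        field_simp
    _ ≤ ρ := by nlinarith

end NoiseWeights

section CorrelatedEstimator

/-- The sign `(-1)^a` of a bit. -/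
def bitSign (a : ZMod 2) : ℝ := if a = 0 then 1 else -1

theorem bitSign_add (a b : ZMod 2) : bitSign (a + b) = bitSign a * bitSign b := by
  have h : (1 : ZMod 2) + 1 = 0 := by decide
  rcases zmod_two_eq_zero_or_one a with rfl | rfl <;>
    rcases zmod_two_eq_zero_or_one b with rfl | rfl <;> simp [bitSign, h]

theorem bitSign_mul_self (a : ZMod 2) : bitSign a * bitSign a = 1 := by
  rcases zmod_two_eq_zero_or_one a with rfl | rfl <;> simp [bitSign]

theorem add_add_self_cube {ι : Type*} (y e : ι → ZMod 2) : y + e + e = y := by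
  funext v
  simp only [Pi.add_apply, add_assoc, CharTwo.add_self_eq_zero, add_zero]

variable {ι : Type*} [Fintype ι] [DecidableEq ι] {δ : ℝ}

theorem sum_cube_add_right {M : Type*} [AddCommMonoid M] (f : (ι → ZMod 2) → M)
    (c : ι → ZMod 2) : ∑ y, f (y + c) = ∑ y, f y :=
  Equiv.sum_comp (Equiv.addRight c) f

/-- Summing out one coordinate loses more entropy after other coordinates were summed out. -/
theorem sum_mul_log_div_add_le {q g : (ι → ZMod 2) → ℝ} (hq : ∀ y, 0 < q y) (hg : ∀ y, 0 < g y)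
    (e : ι → ZMod 2) :
    ∑ y, q y * Real.log (g y / (g y + g (y + e)))
      ≤ ∑ y, q y * Real.log (q y / (q y + q (y + e))) := by
  have hpt : ∀ y, q y * Real.log (g y / (g y + g (y + e)))
      ≤ q y * Real.log (q y / (q y + q (y + e)))
        + ((g y * q y / (g y + g (y + e)) + g y * q (y + e) / (g y + g (y + e))) - q y) := by
    intro y
    have h1 := hq y
    have h2 := hq (y + e)
    have h3 := hg y
    have h4 := hg (y + e)
    have hlog := Real.log_le_sub_one_of_pos
      (show 0 < (g y / (g y + g (y + e))) / (q y / (q y + q (y + e))) by positivity)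
    rw [Real.log_div (by positivity) (by positivity)] at hlog
    have := mul_le_mul_of_nonneg_left hlog h1.le
    have heq : q y * ((g y / (g y + g (y + e))) / (q y / (q y + q (y + e))) - 1)
        = (g y * q y / (g y + g (y + e)) + g y * q (y + e) / (g y + g (y + e))) - q y := by
      field_simp
    linarith
  have hswap : ∑ y, g y * q (y + e) / (g y + g (y + e))
      = ∑ y, g (y + e) * q y / (g y + g (y + e)) := by
    rw [← sum_cube_add_right _ e]
    refine Finset.sum_congr rfl fun y _ => ?_
    rw [add_add_self_cube, add_comm (g y)]
  have hzero : ∑ y, ((g y * q y / (g y + g (y + e)) + g y * q (y + e) / (g y + g (y + e)))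
      - q y) = 0 := by
    rw [Finset.sum_sub_distrib, Finset.sum_add_distrib, hswap, ← Finset.sum_add_distrib,
      sub_eq_zero]
    refine Finset.sum_congr rfl fun y _ => ?_
    have h3 := hg y
    have h4 := hg (y + e)
    field_simp
  calc _ ≤ _ := Finset.sum_le_sum fun y _ => hpt y
    _ = _ := by rw [Finset.sum_add_distrib, hzero, add_zero]

/-- Subadditivity of the entropy deficit on the cube. -/
theorem sum_mul_log_le_sum_sum {q : (ι → ZMod 2) → ℝ} (hq : ∀ y, 0 < q y)
    (hsum : ∑ y, q y = 1) :
    ∑ y, q y * Real.log (q y)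
      ≤ ∑ v, ∑ y, q y * Real.log (q y / (q y + q (y + Pi.single v 1))) := by
  classical
  set M : Finset ι → (ι → ZMod 2) → ℝ := fun S y =>
    ∑ y', if ∀ u, u ∉ S → y' u = y u then q y' else 0 with hM
  have hMpos : ∀ S y, 0 < M S y := by
    intro S y
    refine Finset.sum_pos' (fun y' _ => ?_) ⟨y, Finset.mem_univ _, by simp [hq y]⟩
    split_ifs
    exacts [(hq y').le, le_rfl]
  have hMins : ∀ S v y, v ∉ S → M (insert v S) y = M S y + M S (y + Pi.single v 1) := by
    intro S v y hv
    simp only [hM, ← Finset.sum_add_distrib]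
    refine Finset.sum_congr rfl fun y' _ => ?_
    have hA : (∀ u, u ∉ S → y' u = y u) ↔ (∀ u, u ∉ insert v S → y' u = y u) ∧ y' v = y v := by
      constructor
      · exact fun h => ⟨fun u hu => h u fun h' => hu (Finset.mem_insert_of_mem h'), h v hv⟩
      · rintro ⟨h, h'⟩ u hu
        by_cases huv : u = v
        · exact huv ▸ h'
        · exact h u (by simp [huv, hu])
    have hB : (∀ u, u ∉ S → y' u = (y + Pi.single v 1 : ι → ZMod 2) u)
        ↔ (∀ u, u ∉ insert v S → y' u = y u) ∧ y' v = y v + 1 := by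
      constructor
      · refine fun h => ⟨fun u hu => ?_, by simpa using h v hv⟩
        have huv : u ≠ v := fun h' => hu (by simp [h'])
        simpa [huv] using h u fun h' => hu (Finset.mem_insert_of_mem h')
      · rintro ⟨h, h'⟩ u hu
        by_cases huv : u = v
        · subst huv
          simpa using h'
        · simpa [huv] using h u (by simp [huv, hu])
    rw [if_congr hA rfl rfl, if_congr hB rfl rfl]
    by_cases h : ∀ u, u ∉ insert v S → y' u = y u
    · have : ∀ a b : ZMod 2, (a = b ∧ a ≠ b + 1) ∨ (a ≠ b ∧ a = b + 1) := by decide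
      rcases this (y' v) (y v) with h' | h'
      · rw [if_pos h, if_pos ⟨h, h'.1⟩, if_neg fun h'' => h'.2 h''.2, add_zero]
      · rw [if_pos h, if_neg fun h'' => h'.1 h''.2, if_pos ⟨h, h'.2⟩, zero_add]
    · rw [if_neg h, if_neg fun h'' => h h''.1, if_neg fun h'' => h h''.1, add_zero]
  have hind : ∀ S : Finset ι, ∑ y, q y * Real.log (q y)
      ≤ ∑ v ∈ S, ∑ y, q y * Real.log (q y / (q y + q (y + Pi.single v 1)))
        + ∑ y, q y * Real.log (M S y) := by
    intro S
    induction S using Finset.induction_on with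
    | empty =>
      have : ∀ y, M ∅ y = q y := by
        intro y
        have : ∀ y', (∀ u, u ∉ (∅ : Finset ι) → y' u = y u) ↔ y = y' := fun y' => by
          simp [funext_iff, eq_comm]
        simp only [hM, if_congr (this _) rfl rfl, Finset.sum_ite_eq, Finset.mem_univ, if_true]
      simp [this]
    | insert v S hv ih =>
      have hstep := sum_mul_log_div_add_le hq (hMpos S) (Pi.single v 1)
      simp only [← hMins S v _ hv] at hstep
      have hsplit : ∑ y, q y * Real.log (M S y / M (insert v S) y)
          = ∑ y, q y * Real.log (M S y) - ∑ y, q y * Real.log (M (insert v S) y) := by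
        rw [← Finset.sum_sub_distrib]
        refine Finset.sum_congr rfl fun y _ => ?_
        rw [Real.log_div (hMpos _ _).ne' (hMpos _ _).ne', mul_sub]
      rw [Finset.sum_insert hv]
      linarith
  have h := hind Finset.univ
  have huniv : ∀ y, M Finset.univ y = 1 := by
    intro y
    simp [hM, hsum]
  simpa [huniv] using h

theorem noiseWeight_add_single_mul (δ : ℝ) (z : ι → ZMod 2) (v : ι) :
    noiseWeight δ (z + Pi.single v 1) * bitWeight δ (z v)
      = noiseWeight δ z * bitWeight δ (z v + 1) := by
  unfold noiseWeight
  rw [← Finset.mul_prod_erase _ _ (Finset.mem_univ v),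
    ← Finset.mul_prod_erase _ (fun u => bitWeight δ (z u)) (Finset.mem_univ v)]
  have : ∏ u ∈ Finset.univ.erase v, bitWeight δ ((z + Pi.single v 1 : ι → ZMod 2) u)
      = ∏ u ∈ Finset.univ.erase v, bitWeight δ (z u) := by
    refine Finset.prod_congr rfl fun u hu => ?_
    simp [Finset.ne_of_mem_erase hu]
  rw [this]
  simp
  ring

theorem sum_noiseWeight_mul_bitSign_mul (hδ : δ ∈ Set.Ioo (0 : ℝ) 1) (v : ι)
    {g : (ι → ZMod 2) → ℝ} (hg : ∀ z, g (z + Pi.single v 1) = g z) :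
    ∑ z, noiseWeight δ z * (bitSign (z v) * g z)
      = (1 - 2 * δ) * ∑ z, noiseWeight δ z * g z := by
  set F : (ι → ZMod 2) → ℝ := fun z =>
    noiseWeight δ z * ((bitSign (z v) - (1 - 2 * δ)) * g z) with hF
  have hpair : ∀ z, F z + F (z + Pi.single v 1) = 0 := by
    intro z
    have hw := bitWeight_pos hδ (z v)
    have hrel := noiseWeight_add_single_mul δ z v
    have hbit : bitWeight δ (z v) * (bitSign (z v) - (1 - 2 * δ))
        + bitWeight δ (z v + 1) * (bitSign (z v + 1) - (1 - 2 * δ)) = 0 := by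
      have h : (1 : ZMod 2) + 1 = 0 := by decide
      rcases zmod_two_eq_zero_or_one (z v) with hz | hz <;>
        simp [hz, h, bitWeight, bitSign] <;> ring
    have hmul : bitWeight δ (z v) * (F z + F (z + Pi.single v 1)) = 0 := by
      simp only [hF, hg, Pi.add_apply, Pi.single_eq_same]
      linear_combination (bitSign (z v + 1) - (1 - 2 * δ)) * g z * hrel
        + noiseWeight δ z * g z * hbit
    exact (mul_eq_zero.1 hmul).resolve_left hw.ne'
  have hsum : ∑ z, F z = 0 := by
    have h1 := sum_cube_add_right F (Pi.single v 1)
    have h2 : ∑ z, (F z + F (z + Pi.single v 1)) = 0 := Finset.sum_eq_zero fun z _ => hpair z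
    rw [Finset.sum_add_distrib] at h2
    linarith
  rw [Finset.mul_sum, ← sub_eq_zero, ← Finset.sum_sub_distrib, ← hsum]
  exact Finset.sum_congr rfl fun z _ => by simp only [hF]; ring

theorem sum_noiseWeight_mul_log (hδ : δ ∈ Set.Ioo (0 : ℝ) 1) :
    ∑ z : ι → ZMod 2, noiseWeight δ z * Real.log (noiseWeight δ z)
      = Fintype.card ι * (δ * Real.log δ + (1 - δ) * Real.log (1 - δ)) := by
  have hlog : ∀ z : ι → ZMod 2, Real.log (noiseWeight δ z) = ∑ v, Real.log (bitWeight δ (z v)) :=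
    fun z => Real.log_prod fun v _ => (bitWeight_pos hδ (z v)).ne'
  simp only [hlog, Finset.mul_sum]
  rw [Finset.sum_comm]
  simp only [sum_noiseWeight_mul_apply δ (fun a => Real.log (bitWeight δ a)), Finset.sum_const,
    Finset.card_univ, nsmul_eq_mul, sum_zmod_two]
  simp only [bitWeight, if_true, zero_ne_one, if_false]
  ring

/-- For a linear code below capacity, some coordinate of the codeword is correlated with a bounded
estimator which observes only the other coordinates of the noisy codeword. -/
theorem exists_correlated_estimator [Nonempty ι] (hδ : δ ∈ Set.Ioo (0 : ℝ) (1 / 2))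
    (C : Submodule (ZMod 2) (ι → ZMod 2)) {k β : ℝ} (hk : Real.log (Nat.card C) ≤ k * Real.log 2)
    (hβ0 : 0 ≤ β)
    (hβ : β * Fintype.card ι ≤ Fintype.card ι * Real.log 2 - k * Real.log 2
      + Fintype.card ι * (δ * Real.log δ + (1 - δ) * Real.log (1 - δ))) :
    ∃ (i : ι) (s : ({v // v ≠ i} → ZMod 2) → ℝ), (∀ y, |s y| ≤ 1) ∧
      (∀ y : ι → ZMod 2, ∀ c ∈ C, s ((y + c) ∘ Subtype.val)
        = bitSign (c i) * s (y ∘ Subtype.val)) ∧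
      β ≤ ∑ y, noiseWeight δ y * s y := by
  classical
  have hδ' : δ ∈ Set.Ioo (0 : ℝ) 1 := ⟨hδ.1, by linarith [hδ.2]⟩
  set K : ℝ := (Nat.card C : ℝ) with hK
  have hKpos : 0 < K := by rw [hK]; exact_mod_cast Nat.card_pos
  set q : (ι → ZMod 2) → ℝ := fun y => K⁻¹ * ∑ c : C, noiseWeight δ (y + c.1) with hq
  have hqge : ∀ y, K⁻¹ * noiseWeight δ y ≤ q y := by
    intro y
    refine mul_le_mul_of_nonneg_left ?_ (by positivity)
    have := Finset.single_le_sum (f := fun c : C => noiseWeight δ (y + c.1))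
      (fun c _ => (noiseWeight_pos hδ' _).le) (Finset.mem_univ (0 : C))
    simpa using this
  have hqpos : ∀ y, 0 < q y := fun y =>
    lt_of_lt_of_le (mul_pos (by positivity) (noiseWeight_pos hδ' y)) (hqge y)
  have hqinv : ∀ y, ∀ c ∈ C, q (y + c) = q y := by
    intro y c hc
    simp only [hq]
    congr 1
    rw [← Equiv.sum_comp (Equiv.addLeft (⟨c, hc⟩ : C)) fun d : C => noiseWeight δ (y + d.1)]
    refine Finset.sum_congr rfl fun d _ => ?_
    simp [add_assoc]
  have havg : ∀ h : (ι → ZMod 2) → ℝ, (∀ y, ∀ c ∈ C, h (y + c) = h y) →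
      ∑ y, q y * h y = ∑ z, noiseWeight δ z * h z := by
    intro h hinv
    simp only [hq, mul_assoc, Finset.sum_mul]
    rw [← Finset.mul_sum, Finset.sum_comm]
    have : ∀ c : C, ∑ y, noiseWeight δ (y + c.1) * h y = ∑ z, noiseWeight δ z * h z := by
      intro c
      rw [← sum_cube_add_right (fun z => noiseWeight δ z * h z) c.1]
      exact Finset.sum_congr rfl fun y _ => by rw [hinv y c.1 c.2]
    simp only [this, Finset.sum_const, Finset.card_univ, nsmul_eq_mul, ← Nat.card_eq_fintype_card,
      ← hK]
    field_simp
  have hqsum : ∑ y, q y = 1 := by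
    have := havg (fun _ => 1) fun _ _ _ => rfl
    simpa [sum_noiseWeight] using this
  have hent : Fintype.card ι * (δ * Real.log δ + (1 - δ) * Real.log (1 - δ)) - k * Real.log 2
      ≤ ∑ y, q y * Real.log (q y) := by
    rw [havg (fun y => Real.log (q y)) fun y c hc => by simp only [hqinv y c hc],
      ← sum_noiseWeight_mul_log hδ', ← mul_one (k * Real.log 2), ← sum_noiseWeight (ι := ι) δ,
      Finset.mul_sum, ← Finset.sum_sub_distrib]
    refine Finset.sum_le_sum fun z _ => ?_
    have hp := noiseWeight_pos hδ' z
    have h1 := Real.log_le_log (mul_pos (inv_pos.2 hKpos) hp) (hqge z)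
    rw [Real.log_mul (by positivity) hp.ne', Real.log_inv] at h1
    nlinarith
  set d : ι → (ι → ZMod 2) → ℝ := fun v y =>
    (q y - q (y + Pi.single v 1)) / (q y + q (y + Pi.single v 1)) with hd
  have hdsum : β * Fintype.card ι ≤ ∑ v, ∑ y, q y * d v y := by
    have hsub := sum_mul_log_le_sum_sum hqpos hqsum
    have hv : ∀ v, ∑ y, q y * Real.log (q y / (q y + q (y + Pi.single v 1))) + Real.log 2
        ≤ ∑ y, q y * d v y := by
      intro v
      rw [← one_mul (Real.log 2), ← hqsum, Finset.sum_mul, ← Finset.sum_add_distrib]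
      refine Finset.sum_le_sum fun y _ => ?_
      have h1 := hqpos y
      have h2 := hqpos (y + Pi.single v 1)
      have hlog := Real.log_le_sub_one_of_pos
        (show 0 < q y / (q y + q (y + Pi.single v 1)) * 2 by positivity)
      rw [Real.log_mul (by positivity) (by norm_num)] at hlog
      rw [← mul_add]
      refine mul_le_mul_of_nonneg_left (hlog.trans_eq ?_) h1.le
      simp only [hd]
      field_simp
      ring
    have hall := Finset.sum_le_sum fun v (_ : v ∈ (Finset.univ : Finset ι)) => hv v
    rw [Finset.sum_add_distrib, Finset.sum_const, Finset.card_univ, nsmul_eq_mul] at hall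
    linarith
  obtain ⟨i, -, hi⟩ : ∃ i ∈ (Finset.univ : Finset ι), β ≤ ∑ y, q y * d i y := by
    refine Finset.exists_le_of_sum_le Finset.univ_nonempty ?_
    simpa [mul_comm] using hdsum
  have hdflip : ∀ y, d i (y + Pi.single i 1) = -d i y := by
    intro y
    simp only [hd, add_add_self_cube]
    rw [← neg_div, neg_sub, add_comm (q y)]
  have hdinv : ∀ y, ∀ c ∈ C, d i (y + c) = d i y := by
    intro y c hc
    simp only [hd, hqinv y c hc, add_right_comm y c, hqinv _ c hc]
  have hdabs : ∀ y, |d i y| ≤ 1 := by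
    intro y
    have h1 := hqpos y
    have h2 := hqpos (y + Pi.single i 1)
    simp only [hd]
    rw [abs_div, abs_of_pos (add_pos h1 h2), div_le_one (add_pos h1 h2), abs_le]
    constructor <;> linarith
  set s : ({v // v ≠ i} → ZMod 2) → ℝ := fun y =>
    d i fun u => if h : u ≠ i then y ⟨u, h⟩ else 0 with hs
  have hsd : ∀ y : ι → ZMod 2, s (y ∘ Subtype.val) = bitSign (y i) * d i y := by
    intro y
    simp only [hs, Function.comp]
    rcases zmod_two_eq_zero_or_one (y i) with hy | hy
    · have : (fun u => if h : u ≠ i then y u else 0) = y := by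
        funext u
        by_cases hu : u = i
        · simp [hu, hy]
        · simp [hu]
      rw [this, hy]
      simp [bitSign]
    · have : (fun u => if h : u ≠ i then y u else 0) = y + Pi.single i 1 := by
        funext u
        by_cases hu : u = i
        · subst hu
          simp only [ne_eq, not_true_eq_false, dite_false, Pi.add_apply, hy, Pi.single_eq_same]
          decide
        · simp [hu]
      rw [this, hy, hdflip y]
      simp [bitSign]
  refine ⟨i, s, fun y => ?_, fun y c hc => ?_, ?_⟩
  · exact hdabs _
  · rw [hsd, hsd, hdinv y c hc, Pi.add_apply, bitSign_add]
    ring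
  · have h1 : ∑ y, q y * d i y
        = ∑ z : ι → ZMod 2, noiseWeight δ z * (bitSign (z i) * s (z ∘ Subtype.val)) := by
      rw [havg _ hdinv]
      refine Finset.sum_congr rfl fun z _ => ?_
      rw [hsd, ← mul_assoc (bitSign _), bitSign_mul_self, one_mul]
    rw [sum_noiseWeight_mul_bitSign_mul hδ' i (g := fun z => s (z ∘ Subtype.val)),
      sum_noiseWeight_comp hδ' Subtype.val_injective s] at h1
    · rw [h1] at hi
      nlinarith [hδ.1, hδ.2]
    · intro z
      congr 1
      funext u
      simp [u.2]

end CorrelatedEstimator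

section ReedMuller

/-- The evaluation vector of the multilinear monomial `∏ i ∈ S, x i`. -/
def monomialEval {m : ℕ} (S : Finset (Fin m)) : Idx m → ZMod 2 := fun x => ∏ i ∈ S, x i

/-- The Reed–Muller code: evaluations of the polynomials of degree at most `r`. -/
def rmCode (m r : ℕ) : Submodule (ZMod 2) (Idx m → ZMod 2) :=
  Submodule.span (ZMod 2) (monomialEval '' {S : Finset (Fin m) | S.card ≤ r})

theorem monomialEval_mem_rmCode {m r : ℕ} {S : Finset (Fin m)} (hS : S.card ≤ r) :
    monomialEval S ∈ rmCode m r :=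
  Submodule.subset_span ⟨S, hS, rfl⟩

theorem rmCode_mono {m r r' : ℕ} (h : r ≤ r') : rmCode m r ≤ rmCode m r' :=
  Submodule.span_mono (Set.image_mono fun _ hS => le_trans hS h)

theorem card_filter_card_le (α : Type*) [Fintype α] (r : ℕ) :
    (Finset.univ.filter fun S : Finset α => S.card ≤ r).card = binomLe (Fintype.card α) r := by
  classical
  rw [binomLe, Finset.card_eq_sum_card_fiberwise (f := Finset.card) (t := Finset.range (r + 1))]
  · refine Finset.sum_congr rfl fun i hi => ?_
    rw [Finset.filter_filter]
    have : (Finset.univ.filter fun S : Finset α => S.card ≤ r ∧ S.card = i)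
        = Finset.powersetCard i Finset.univ := by
      ext S
      have := Finset.mem_range.1 hi
      simp [Finset.mem_powersetCard]
      omega
    rw [this, Finset.card_powersetCard, Finset.card_univ]
  · intro S hS
    simp at hS ⊢
    omega

theorem log_card_rmCode_le (m r : ℕ) :
    Real.log (Nat.card (rmCode m r)) ≤ binomLe m r * Real.log 2 := by
  classical
  have hfr : Module.finrank (ZMod 2) (rmCode m r) ≤ binomLe m r := by
    have h := finrank_span_finset_le_card (R := ZMod 2)
      ((Finset.univ.filter fun S : Finset (Fin m) => S.card ≤ r).image monomialEval)
    have hset : (((Finset.univ.filter fun S : Finset (Fin m) => S.card ≤ r).image monomialEval :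
        Finset (Idx m → ZMod 2)) : Set (Idx m → ZMod 2))
        = monomialEval '' {S : Finset (Fin m) | S.card ≤ r} := by
      simp
    rw [Set.finrank, hset] at h
    refine h.trans (Finset.card_image_le.trans ?_)
    rw [card_filter_card_le, Fintype.card_fin]
  rw [Module.natCard_eq_pow_finrank (K := ZMod 2) (V := rmCode m r), Nat.card_zmod,
    Nat.cast_pow, Real.log_pow]
  exact mul_le_mul_of_nonneg_right (by exact_mod_cast hfr) (Real.log_nonneg (by norm_num))

theorem coord_mul_mem_rmCode {m r : ℕ} {f : Idx m → ZMod 2} (hf : f ∈ rmCode m r) (l : Fin m) :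
    (fun u => u l * f u) ∈ rmCode m (r + 1) := by
  classical
  induction hf using Submodule.span_induction with
  | mem f hf =>
    obtain ⟨S, hS, rfl⟩ := hf
    have : (fun u : Idx m => u l * monomialEval S u) = monomialEval (insert l S) := by
      funext u
      by_cases hl : l ∈ S
      · rw [Finset.insert_eq_of_mem hl]
        simp only [monomialEval]
        rw [← Finset.mul_prod_erase S u hl, ← mul_assoc]
        have : ∀ a : ZMod 2, a * a = a := by decide
        rw [this]
      · simp only [monomialEval]
        rw [Finset.prod_insert hl]
    rw [this]
    exact monomialEval_mem_rmCode ((Finset.card_insert_le _ _).trans (Nat.succ_le_succ hS))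
  | zero => simp only [Pi.zero_apply, mul_zero]; exact zero_mem _
  | add f g _ _ hf hg =>
    simp only [Pi.add_apply, mul_add]
    exact add_mem hf hg
  | smul a f _ hf =>
    simp only [Pi.smul_apply, smul_eq_mul, mul_left_comm _ a]
    exact Submodule.smul_mem _ a hf

theorem affine_mul_mem_rmCode {m r : ℕ} {f : Idx m → ZMod 2} (hf : f ∈ rmCode m r)
    (b : ZMod 2) (L : Idx m →ₗ[ZMod 2] ZMod 2) :
    (fun u => (b + L u) * f u) ∈ rmCode m (r + 1) := by
  have h : (fun u => (b + L u) * f u)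
      = b • f + ∑ l, L (Pi.single l 1) • fun u : Idx m => u l * f u := by
    funext u
    rw [LinearMap.pi_apply_eq_sum_univ L u]
    simp only [Pi.add_apply, Pi.smul_apply, Finset.sum_apply, smul_eq_mul, add_mul,
      Finset.sum_mul]
    congr 1
    refine Finset.sum_congr rfl fun l _ => ?_
    have : (fun j => if l = j then (1 : ZMod 2) else 0) = Pi.single l 1 := by
      funext j
      simp [Pi.single_apply, eq_comm]
    rw [this]
    ring
  rw [h]
  exact add_mem (Submodule.smul_mem _ _ (rmCode_mono (Nat.le_succ r) hf))
    (Submodule.sum_mem _ fun l _ => Submodule.smul_mem _ _ (coord_mul_mem_rmCode hf l))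

/-- Reed–Muller codes are stable under affine substitutions. -/
theorem comp_affine_mem_rmCode {m m' r : ℕ} {c : Idx m → ZMod 2} (hc : c ∈ rmCode m r)
    (x : Idx m) (L : Idx m' →ₗ[ZMod 2] Idx m) : (fun u => c (x + L u)) ∈ rmCode m' r := by
  classical
  induction hc using Submodule.span_induction with
  | mem c hc =>
    obtain ⟨S, hS, rfl⟩ := hc
    refine rmCode_mono hS ?_
    clear hS
    induction S using Finset.induction_on with
    | empty => exact monomialEval_mem_rmCode (S := ∅) le_rfl
    | insert j S hj ih =>
      rw [Finset.card_insert_of_notMem hj]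
      have := affine_mul_mem_rmCode ih (x j) ((LinearMap.proj j).comp L)
      simp only [monomialEval, Finset.prod_insert hj]
      exact this
  | zero => exact zero_mem _
  | add f g _ _ hf hg => exact add_mem hf hg
  | smul a f _ hf => exact Submodule.smul_mem _ a hf

theorem Gmat_apply_eq_monomialEval {m : ℕ} (x y : Idx m) :
    Gmat m x y = monomialEval (Finset.univ.filter fun i => y i = 1) x := by
  have hb : ∀ a b : ZMod 2, base a b = if b = 1 then a else 1 := by unfold base; decide
  simp only [Gmat, monomialEval, hb, Finset.prod_filter]

theorem Gmat_mul_self (m : ℕ) : Gmat m * Gmat m = 1 := by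
  ext x y
  have hb : ∀ a b : ZMod 2, ∑ w, base a w * base w b = if a = b then 1 else 0 := by
    unfold base; decide
  simp only [Matrix.mul_apply, Gmat, ← Finset.prod_mul_distrib]
  rw [← Fintype.prod_sum (f := fun i w => base (x i) w * base w (y i))]
  simp only [hb, Matrix.one_apply, funext_iff, Finset.prod_ite_zero, Finset.prod_const_one,
    Finset.mem_univ, true_implies]

theorem Gmat_mulVec_mulVec {m : ℕ} (z : Idx m → ZMod 2) :
    (Gmat m).mulVec ((Gmat m).mulVec z) = z := by
  rw [Matrix.mulVec_mulVec, Gmat_mul_self, Matrix.one_mulVec]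

theorem Gmat_mulVec_mem_rmCode {m r : ℕ} {u : Idx m → ZMod 2} (hu : ∀ y, r < wt y → u y = 0) :
    (Gmat m).mulVec u ∈ rmCode m r := by
  have h : (Gmat m).mulVec u
      = ∑ y, u y • monomialEval (Finset.univ.filter fun i => y i = 1) := by
    funext x
    simp only [Matrix.mulVec, dotProduct, Gmat_apply_eq_monomialEval, Finset.sum_apply,
      Pi.smul_apply, smul_eq_mul]
    exact Finset.sum_congr rfl fun _ _ => mul_comm _ _
  rw [h]
  refine Submodule.sum_mem _ fun y _ => ?_
  by_cases hy : r < wt y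
  · rw [hu y hy, zero_smul]
    exact zero_mem _
  · exact Submodule.smul_mem _ _ (monomialEval_mem_rmCode (not_lt.1 hy))

end ReedMuller

section BitEstimator

/-- Extension by zero, as a linear embedding of cubes. -/
def padZero (m' m : ℕ) : Idx m' →ₗ[ZMod 2] Idx m where
  toFun u := fun i => if h : (i : ℕ) < m' then u ⟨i, h⟩ else 0
  map_add' u v := by
    funext i
    by_cases h : (i : ℕ) < m' <;> simp [h]
  map_smul' a u := by
    funext i
    by_cases h : (i : ℕ) < m' <;> simp [h]

theorem padZero_injective {m' m : ℕ} (h : m' ≤ m) : Function.Injective (padZero m' m) := by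
  intro u v huv
  funext i
  have := congrFun huv ⟨i, i.2.trans_le h⟩
  simpa [padZero] using this

/-- A family of linear embeddings of cubes such that each pair of nonzero vectors is matched by at
most one member. -/
theorem exists_linear_embeddings {m m' : ℕ} (hm : 0 < m) (hle : m' ≤ m) :
    ∃ L : (GaloisField 2 m)ˣ → Idx m' →ₗ[ZMod 2] Idx m,
      (∀ a, Function.Injective (L a)) ∧ ∀ a b u, u ≠ 0 → L a u = L b u → a = b := by
  have hfr : Module.finrank (ZMod 2) (GaloisField 2 m) = m := GaloisField.finrank 2 hm.ne'
  set e : GaloisField 2 m ≃ₗ[ZMod 2] Idx m :=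
    (Module.finBasisOfFinrankEq (ZMod 2) (GaloisField 2 m) hfr).equivFun
  set L : (GaloisField 2 m)ˣ → Idx m' →ₗ[ZMod 2] Idx m := fun a =>
    e.toLinearMap ∘ₗ (LinearMap.mulLeft (ZMod 2) (a : GaloisField 2 m)) ∘ₗ
      e.symm.toLinearMap ∘ₗ padZero m' m with hL
  have hLapp : ∀ a u, L a u = e (a * e.symm (padZero m' m u)) := fun a u => rfl
  refine ⟨L, fun a u v huv => ?_, fun a b u hu hab => ?_⟩
  · rw [hLapp, hLapp, e.injective.eq_iff, a.mul_right_inj, e.symm.injective.eq_iff] at huv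
    exact padZero_injective hle huv
  · rw [hLapp, hLapp, e.injective.eq_iff] at hab
    have hne : e.symm (padZero m' m u) ≠ 0 := by
      rw [Ne, LinearEquiv.map_eq_zero_iff, ← (padZero m' m).map_zero,
        (padZero_injective hle).eq_iff]
      exact hu
    exact Units.ext (mul_right_cancel₀ hne hab)

/-- Given a restricted code below capacity, each noise bit can be estimated from the coset of the
noise vector modulo the code with small error probability. -/
theorem exists_noise_estimator {δ : ℝ} (hδ : δ ∈ Set.Ioo (0 : ℝ) (1 / 2)) {m m' r : ℕ}
    (hm : 0 < m) (hle : m' ≤ m) {β : ℝ} (hβ0 : 0 < β)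
    (hβ : β * 2 ^ m' ≤ 2 ^ m' * Real.log 2 - binomLe m' r * Real.log 2
      + 2 ^ m' * (δ * Real.log δ + (1 - δ) * Real.log (1 - δ))) :
    ∃ g : (Idx m → ZMod 2) → Idx m → ZMod 2,
      (∀ z, ∀ c ∈ rmCode m r, g (z + c) = g z) ∧
      ∀ x, ∑ z with g z x ≠ z x, noiseWeight δ z ≤ 2 ^ m' / 2 ^ m / β ^ 2 := by
  classical
  have hδ' : δ ∈ Set.Ioo (0 : ℝ) 1 := ⟨hδ.1, by linarith [hδ.2]⟩
  have hcardIdx : ∀ n, Fintype.card (Idx n) = 2 ^ n := fun n => by simp [Idx, ZMod.card]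
  obtain ⟨i, s, hs1, hsC, hsβ⟩ := exists_correlated_estimator hδ (rmCode m' r)
    (log_card_rmCode_le m' r) hβ0.le (by rw [hcardIdx]; exact_mod_cast hβ)
  obtain ⟨L, hLinj, hLsep⟩ := exists_linear_embeddings hm hle
  let _ : Fintype (GaloisField 2 m)ˣ := Fintype.ofFinite _
  set A : Idx m → (GaloisField 2 m)ˣ → Idx m' → Idx m := fun x a u => (x + L a i) + L a u with hA
  have hAi : ∀ x a, A x a i = x := fun x a => add_add_self_cube x (L a i)
  have hAinj : ∀ x a, Function.Injective (A x a) := fun x a u v huv =>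
    hLinj a (add_left_cancel huv)
  set B : Idx m → (GaloisField 2 m)ˣ → {u // u ≠ i} → Idx m := fun x a u => A x a u with hB
  have hBinj : ∀ x a, Function.Injective (B x a) := fun x a =>
    (hAinj x a).comp Subtype.val_injective
  have hJ : (Fintype.card (GaloisField 2 m)ˣ : ℝ) = 2 ^ m - 1 := by
    have h1 : Nat.card (GaloisField 2 m)ˣ = 2 ^ m - 1 := by
      rw [Nat.card_units, GaloisField.card 2 m hm.ne']
    rw [← Nat.card_eq_fintype_card, h1, Nat.cast_sub Nat.one_le_two_pow]
    simp
  have hhit : ∀ x v, (((Finset.univ.filter fun a => v ∈ Set.range (B x a)).card : ℕ) : ℝ)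
      ≤ 2 ^ m' / 2 ^ m * Fintype.card (GaloisField 2 m)ˣ := by
    intro x v
    have hcard : (Finset.univ.filter fun a => v ∈ Set.range (B x a)).card
        ≤ (Finset.univ : Finset {u : Idx m' // u ≠ i}).card := by
      refine Finset.card_le_card_of_forall_subsingleton (fun a u => B x a u = v)
        (fun a ha => ?_) fun u _ a ha b hb => ?_
      · obtain ⟨u, hu⟩ := (Finset.mem_filter.1 ha).2
        exact ⟨u, Finset.mem_univ _, hu⟩
      · have hab : B x a u = B x b u := ha.2.trans hb.2.symm
        simp only [hB, hA, add_assoc, add_right_inj, ← map_add] at hab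
        refine hLsep a b (i + u) (fun h0 => u.2 ?_) hab
        have h1 := add_add_self_cube u.1 i
        rw [add_comm u.1, h0, zero_add] at h1
        exact h1.symm
    rw [Finset.card_univ, Fintype.card_subtype_compl, Fintype.card_subtype_eq, hcardIdx] at hcard
    have hcard' : (((Finset.univ.filter fun a => v ∈ Set.range (B x a)).card : ℕ) : ℝ)
        ≤ 2 ^ m' - 1 := by
      have : (((Finset.univ.filter fun a => v ∈ Set.range (B x a)).card : ℕ) : ℝ)
          ≤ ((2 ^ m' - 1 : ℕ) : ℝ) := by exact_mod_cast hcard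
      rwa [Nat.cast_sub Nat.one_le_two_pow, Nat.cast_pow, Nat.cast_ofNat, Nat.cast_one] at this
    refine hcard'.trans ?_
    have hpow : (2 : ℝ) ^ m' ≤ 2 ^ m := pow_le_pow_right₀ (by norm_num) hle
    have hpos : (0 : ℝ) < 2 ^ m := by positivity
    rw [hJ, div_mul_eq_mul_div, le_div_iff₀ hpos]
    nlinarith
  set F : Idx m → (Idx m → ZMod 2) → ℝ := fun x z =>
    (Fintype.card (GaloisField 2 m)ˣ : ℝ)⁻¹ * ∑ a, s (z ∘ B x a) with hF
  have hFC : ∀ x z, ∀ c ∈ rmCode m r, F x (z + c) = bitSign (c x) * F x z := by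
    intro x z c hc
    simp only [hF]
    rw [mul_left_comm, Finset.mul_sum _ _ (bitSign (c x))]
    congr 1
    refine Finset.sum_congr rfl fun a _ => ?_
    have hmem : c ∘ A x a ∈ rmCode m' r := comp_affine_mem_rmCode hc (x + L a i) (L a)
    have := hsC (z ∘ A x a) _ hmem
    rw [Function.comp_apply, hAi] at this
    exact this
  have hFvar : ∀ x, ∑ z with F x z ≤ 0, noiseWeight δ z ≤ 2 ^ m' / 2 ^ m / β ^ 2 := by
    intro x
    have hvar := variance_average_le hδ' (hBinj x) (hhit x) hs1 (by positivity)
    rw [le_div_iff₀ (by positivity), Finset.sum_mul]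
    refine le_trans ?_ hvar
    rw [Finset.sum_filter]
    refine Finset.sum_le_sum fun z _ => ?_
    have hp := noiseWeight_pos hδ' z
    split_ifs with hz
    · refine mul_le_mul_of_nonneg_left ?_ hp.le
      have hz' : (Fintype.card (GaloisField 2 m)ˣ : ℝ)⁻¹ * ∑ a, s (z ∘ B x a) ≤ 0 := hz
      nlinarith
    · positivity
  refine ⟨fun z x => if 0 < bitSign (z x) * F x z then 0 else 1, fun z c hc => ?_, fun x => ?_⟩
  · funext x
    have : bitSign ((z + c) x) * F x (z + c) = bitSign (z x) * F x z := by
      rw [hFC x z c hc, Pi.add_apply, bitSign_add]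
      linear_combination bitSign (z x) * F x z * bitSign_mul_self (c x)
    simp only [this]
  · refine le_trans (Finset.sum_le_sum_of_subset_of_nonneg ?_
      fun z _ _ => (noiseWeight_pos hδ' z).le) (hFvar x)
    intro z hz
    simp only [Finset.mem_filter, Finset.mem_univ, true_and] at hz ⊢
    by_contra! hpos
    refine hz ?_
    rcases zmod_two_eq_zero_or_one (z x) with h | h
    · simp [h, bitSign, hpos]
    · simp [h, bitSign, hpos.le]

end BitEstimator

section BinomialBounds

theorem centralBinom_sq_mul_le (n : ℕ) : n.centralBinom ^ 2 * (2 * n + 1) ≤ 4 ^ (2 * n) := by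
  induction n with
  | zero => simp
  | succ n ih =>
    have h := Nat.succ_mul_centralBinom_succ n
    refine Nat.le_of_mul_le_mul_left ?_ (show 0 < (n + 1) ^ 2 by positivity)
    calc (n + 1) ^ 2 * ((n + 1).centralBinom ^ 2 * (2 * (n + 1) + 1))
        = ((n + 1) * (n + 1).centralBinom) ^ 2 * (2 * n + 3) := by ring
      _ = 4 * ((2 * n + 1) * (2 * n + 3)) * (n.centralBinom ^ 2 * (2 * n + 1)) := by
        rw [h]; ring
      _ ≤ 4 * (4 * (n + 1) ^ 2) * 4 ^ (2 * n) := by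
        refine Nat.mul_le_mul (Nat.mul_le_mul_left _ ?_) ih
        nlinarith
      _ = (n + 1) ^ 2 * 4 ^ (2 * (n + 1)) := by ring

theorem choose_sq_mul_le (n r : ℕ) : n.choose r ^ 2 * (n + 1) ≤ 4 ^ n := by
  obtain ⟨k, rfl | rfl⟩ := Nat.even_or_odd' n
  · refine le_trans ?_ (centralBinom_sq_mul_le k)
    gcongr
    exact Nat.choose_le_centralBinom r k
  · have h1 : (2 * k + 1).choose r ≤ (2 * k + 1).choose k := by
      have := Nat.choose_le_middle r (2 * k + 1)
      rwa [show (2 * k + 1) / 2 = k by omega] at this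
    have h2 : (k + 1).centralBinom = 2 * (2 * k + 1).choose k := by
      rw [Nat.centralBinom, show 2 * (k + 1) = (2 * k + 1) + 1 by ring, Nat.choose_succ_succ,
        ← Nat.choose_symm_half k]
      ring
    have h3 := centralBinom_sq_mul_le (k + 1)
    rw [h2] at h3
    have h4 : (2 * k + 1).choose r ^ 2 * (2 * k + 1 + 1)
        ≤ (2 * k + 1).choose k ^ 2 * (2 * (k + 1) + 1) := by
      gcongr
      omega
    have h5 : 4 ^ (2 * (k + 1)) = 4 * 4 ^ (2 * k + 1) := by ring
    nlinarith

theorem binomLe_succ_add (n r : ℕ) : binomLe (n + 1) r + n.choose r = 2 * binomLe n r := by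
  induction r with
  | zero => simp [binomLe]
  | succ r ih =>
    simp only [binomLe] at ih ⊢
    rw [Finset.sum_range_succ, Finset.sum_range_succ _ (r + 1), Nat.choose_succ_succ']
    omega

theorem binomLe_le_two_pow (n r : ℕ) : binomLe n r ≤ 2 ^ n := by
  have h := card_filter_card_le (Fin n) r
  rw [Fintype.card_fin] at h
  rw [← h]
  refine (Finset.card_le_univ _).trans ?_
  simp

theorem binomLe_le_pow (n r : ℕ) : binomLe n r ≤ (n + 1) ^ r := by
  induction r with
  | zero => simp [binomLe]
  | succ r ih =>
    have h1 : binomLe n (r + 1) = binomLe n r + n.choose (r + 1) := by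
      simp [binomLe, Finset.sum_range_succ]
    have h2 : n.choose (r + 1) ≤ n ^ (r + 1) := Nat.choose_le_pow n (r + 1)
    have h3 : n ^ r ≤ (n + 1) ^ r := Nat.pow_le_pow_left (Nat.le_succ n) r
    rw [h1, pow_succ]
    rw [pow_succ] at h2
    nlinarith

/-- Shortening the length exponent by `k` changes the rate of a Reed–Muller code by `O(k / √m)`. -/
theorem binomLe_div_le_add {m' : ℕ} (hm' : 0 < m') (r k : ℕ) :
    (binomLe m' r : ℝ) / 2 ^ m' ≤ binomLe (m' + k) r / 2 ^ (m' + k) + k / (2 * √m') := by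
  induction k with
  | zero => simp
  | succ k ih =>
    refine ih.trans ?_
    have hs : 0 < √(m' : ℝ) := Real.sqrt_pos.2 (by exact_mod_cast hm')
    have h1 : (binomLe (m' + k + 1) r : ℝ) + (m' + k).choose r = 2 * binomLe (m' + k) r := by
      exact_mod_cast binomLe_succ_add (m' + k) r
    have h2 : ((m' + k).choose r : ℝ) * √m' ≤ 2 ^ (m' + k) := by
      refine abs_le_of_sq_le_sq' ?_ (by positivity) |>.2
      rw [mul_pow, Real.sq_sqrt (by positivity)]
      have h3 : ((m' + k).choose r : ℝ) ^ 2 * ((m' + k : ℕ) + 1) ≤ 4 ^ (m' + k) := by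
        exact_mod_cast choose_sq_mul_le (m' + k) r
      have h4 : ((2 : ℝ) ^ (m' + k)) ^ 2 = 4 ^ (m' + k) := by
        rw [← pow_mul, mul_comm, pow_mul]; norm_num
      rw [h4]
      refine le_trans ?_ h3
      gcongr
      push_cast
      linarith
    have h5 : (binomLe (m' + k) r : ℝ) / 2 ^ (m' + k)
        = binomLe (m' + k + 1) r / 2 ^ (m' + k + 1)
          + (m' + k).choose r / 2 ^ (m' + k + 1) := by
      rw [← add_div, h1, pow_succ]
      field_simp
    have h6 : ((m' + k).choose r : ℝ) / 2 ^ (m' + k + 1) ≤ 1 / (2 * √m') := by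
      rw [div_le_div_iff₀ (by positivity) (by positivity), pow_succ]
      linarith
    rw [h5, ← add_assoc m' k 1]
    push_cast
    rw [add_div (k : ℝ)]
    linarith

theorem card_hammingDist_le {ι : Type*} [Fintype ι] [DecidableEq ι] (y : ι → ZMod 2) (D : ℕ) :
    (Finset.univ.filter fun z => hammingDist y z ≤ D).card ≤ (Fintype.card ι + 1) ^ D := by
  refine le_trans ?_ ((card_filter_card_le ι D).trans_le (binomLe_le_pow _ D))
  refine Finset.card_le_card_of_injOn (fun z => Finset.univ.filter fun v => y v ≠ z v)
    (fun z hz => by simpa [hammingDist] using hz) fun z _ z' _ h => ?_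
  funext v
  have hv := Finset.ext_iff.1 h v
  simp only [Finset.mem_filter, Finset.mem_univ, true_and] at hv
  have : ∀ a b c : ZMod 2, (a ≠ b ↔ a ≠ c) → b = c := by decide
  exact this _ _ _ hv

end BinomialBounds

section PosteriorLaw

/-- Joint probability mass of the coefficients and the noise. -/
noncomputable def pairWeight (m : ℕ) (δ : ℝ) (p : (Idx m → ZMod 2) × (Idx m → ZMod 2)) : ℝ :=
  (Fintype.card (Idx m → ZMod 2) : ℝ)⁻¹ * noiseWeight δ p.2

instance isFiniteMeasure_bern2 (δ : ℝ) : IsFiniteMeasure (bern2 δ) := by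
  unfold bern2
  refine ⟨?_⟩
  simp

theorem bern2_singleton {δ : ℝ} (a : ZMod 2) :
    bern2 δ {a} = ENNReal.ofReal (bitWeight δ a) := by
  rcases zmod_two_eq_zero_or_one a with rfl | rfl <;> simp [bern2, bitWeight]

theorem unifM_singleton {α : Type*} [Fintype α] [Nonempty α] [MeasurableSpace α]
    [MeasurableSingletonClass α] (a : α) :
    unifM α {a} = ENNReal.ofReal (Fintype.card α : ℝ)⁻¹ := by
  have h : (0 : ℝ) < Fintype.card α := by exact_mod_cast Fintype.card_pos
  simp [unifM, Measure.count_apply, ENNReal.ofReal_inv_of_pos h, ENat.card_eq_coe_fintype_card]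

theorem pairWeight_pos {m : ℕ} {δ : ℝ} (hδ : δ ∈ Set.Ioo (0 : ℝ) 1)
    (p : (Idx m → ZMod 2) × (Idx m → ZMod 2)) : 0 < pairWeight m δ p :=
  mul_pos (inv_pos.2 (by exact_mod_cast Fintype.card_pos)) (noiseWeight_pos hδ p.2)

theorem sum_pairWeight (m : ℕ) (δ : ℝ) : ∑ p, pairWeight m δ p = 1 := by
  simp only [pairWeight, Fintype.sum_prod_type, ← Finset.mul_sum, sum_noiseWeight]
  simp

theorem sum_pairWeight_snd {m : ℕ} (δ : ℝ) (Q : (Idx m → ZMod 2) → Prop) [DecidablePred Q] :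
    ∑ p with Q p.2, pairWeight m δ p = ∑ z with Q z, noiseWeight δ z := by
  rw [Finset.sum_filter, Finset.sum_filter, Fintype.sum_prod_type_right]
  have h : (Fintype.card (Idx m → ZMod 2) : ℝ) ≠ 0 := by exact_mod_cast Fintype.card_ne_zero
  simp only [pairWeight]
  refine Finset.sum_congr rfl fun z _ => ?_
  split_ifs
  · rw [Finset.sum_const, Finset.card_univ, nsmul_eq_mul, mul_inv_cancel_left₀ h]
  · simp

theorem μUZ_singleton {m : ℕ} {δ : ℝ} (hδ : δ ∈ Set.Ioo (0 : ℝ) 1)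
    (p : (Idx m → ZMod 2) × (Idx m → ZMod 2)) :
    μUZ m δ {p} = ENNReal.ofReal (pairWeight m δ p) := by
  have : SigmaFinite (noise m δ) := by unfold noise; infer_instance
  rw [← Prod.mk.eta (p := p), ← Set.singleton_prod_singleton, μUZ, Measure.prod_prod,
    unifM_singleton, noise, Measure.pi_singleton, pairWeight,
    ENNReal.ofReal_mul (by positivity), noiseWeight,
    ENNReal.ofReal_prod_of_nonneg fun v _ => (bitWeight_pos hδ _).le]
  simp only [bern2_singleton]

theorem μUZ_apply {m : ℕ} {δ : ℝ} (hδ : δ ∈ Set.Ioo (0 : ℝ) 1)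
    (S : Set ((Idx m → ZMod 2) × (Idx m → ZMod 2))) [DecidablePred (· ∈ S)] :
    μUZ m δ S = ENNReal.ofReal (∑ p with p ∈ S, pairWeight m δ p) := by
  rw [ENNReal.ofReal_sum_of_nonneg fun p _ => (pairWeight_pos hδ p).le]
  simp only [← μUZ_singleton hδ]
  rw [sum_measure_singleton]
  simp

theorem eq_of_Ule_eq_of_Ugt_eq {m r : ℕ} {p q : (Idx m → ZMod 2) × (Idx m → ZMod 2)}
    (hle : Ule m r p = Ule m r q) (hgt : Ugt m r p = Ugt m r q) (hY : Yf m p = Yf m q) : p = q := by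
  have h1 : p.1 = q.1 := by
    funext x
    rcases le_or_gt (wt x) r with hx | hx
    · exact congrFun hle ⟨x, hx⟩
    · exact congrFun hgt ⟨x, hx⟩
  refine Prod.ext h1 ?_
  unfold Yf at hY
  rw [h1] at hY
  exact add_left_cancel hY

open Classical in
theorem ofReal_le_condP {m r : ℕ} {δ t : ℝ} (hδ : δ ∈ Set.Ioo (0 : ℝ) 1)
    {p₀ : (Idx m → ZMod 2) × (Idx m → ZMod 2)}
    (h : t * ∑ p with Ugt m r p = Ugt m r p₀ ∧ Yf m p = Yf m p₀, pairWeight m δ p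
      ≤ pairWeight m δ p₀) : ENNReal.ofReal t ≤ condP m r δ p₀ := by
  have hs : {p | Ule m r p = Ule m r p₀ ∧ Ugt m r p = Ugt m r p₀ ∧ Yf m p = Yf m p₀} = {p₀} := by
    ext p
    constructor
    · rintro ⟨h1, h2, h3⟩
      exact eq_of_Ule_eq_of_Ugt_eq h1 h2 h3
    · rintro rfl
      exact ⟨rfl, rfl, rfl⟩
  have hpos : 0 < ∑ p with Ugt m r p = Ugt m r p₀ ∧ Yf m p = Yf m p₀, pairWeight m δ p :=
    Finset.sum_pos (fun p _ => pairWeight_pos hδ p) ⟨p₀, by simp⟩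
  rw [condP, condPa, hs, μUZ_apply hδ {p | _ ∧ _}, μUZ_singleton hδ]
  simp only [Set.mem_ofPred_eq]
  rw [← ENNReal.ofReal_div_of_pos hpos]
  exact ENNReal.ofReal_le_ofReal ((le_div_iff₀ hpos).2 h)

theorem sum_condPa_le_one {m r : ℕ} {δ : ℝ} (p₀ : (Idx m → ZMod 2) × (Idx m → ZMod 2))
    (A : Finset ({x : Idx m // wt x ≤ r} → ZMod 2)) : ∑ a ∈ A, condPa m r δ a p₀ ≤ 1 := by
  simp only [condPa, div_eq_mul_inv, ← Finset.sum_mul]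
  refine le_trans ?_ (ENNReal.div_self_le_one
    (a := μUZ m δ {p | Ugt m r p = Ugt m r p₀ ∧ Yf m p = Yf m p₀}))
  rw [div_eq_mul_inv]
  gcongr
  rw [← measure_biUnion_finset]
  · refine measure_mono ?_
    simp only [Set.iUnion_subset_iff]
    rintro a _ p ⟨_, h⟩
    exact h
  · intro a _ b _ hab
    refine Set.disjoint_left.2 ?_
    rintro p ⟨rfl, _⟩ ⟨h, _⟩
    exact hab h
  · intro a _
    exact (Set.toFinite _).measurableSet

theorem ncard_lt_of_ofReal_le_condP {m r : ℕ} {δ t : ℝ} (ht : 0 < t)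
    {p₀ : (Idx m → ZMod 2) × (Idx m → ZMod 2)} (h : ENNReal.ofReal t ≤ condP m r δ p₀) :
    (({a : {x : Idx m // wt x ≤ r} → ZMod 2 | condP m r δ p₀ < condPa m r δ a p₀}).ncard : ℝ)
      < t⁻¹ := by
  classical
  set A := Finset.univ.filter fun a => condP m r δ p₀ < condPa m r δ a p₀ with hA
  have hncard : ({a : {x : Idx m // wt x ≤ r} → ZMod 2 |
      condP m r δ p₀ < condPa m r δ a p₀}).ncard = A.card := by
    rw [← Set.ncard_coe_finset]
    simp [hA]
  rw [hncard]
  rcases A.eq_empty_or_nonempty with h0 | hne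
  · simpa [h0] using ht
  · have h1 : ∑ _a ∈ A, ENNReal.ofReal t < ∑ a ∈ A, condPa m r δ a p₀ :=
      ENNReal.sum_lt_sum_of_nonempty hne fun a ha =>
        h.trans_lt (Finset.mem_filter.1 ha).2
    have h2 := h1.trans_le (sum_condPa_le_one p₀ A)
    rw [Finset.sum_const, nsmul_eq_mul, ← ENNReal.ofReal_natCast,
      ← ENNReal.ofReal_mul (by positivity), ENNReal.ofReal_lt_one] at h2
    rwa [lt_inv_comm₀ (by exact_mod_cast hne.card_pos) ht, ← one_div,
      lt_div_iff₀ (by exact_mod_cast hne.card_pos), mul_comm]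

end PosteriorLaw

section ListDecoding

/-- In a list of at most `N` candidates per observation, those whose posterior probability is below
`t` carry total probability at most `N * t`. -/
theorem sum_weight_of_small_posterior_le {Ω Θ : Type*} [Fintype Ω] [DecidableEq Θ]
    {w : Ω → ℝ} (hw : ∀ p, 0 ≤ w p) (hw1 : ∑ p, w p = 1) (T : Ω → Θ) (B : Finset Ω) {N : ℕ}
    (hB : ∀ θ, (B.filter fun p => T p = θ).card ≤ N) {t : ℝ} (ht : 0 ≤ t) :
    ∑ p ∈ B with w p < t * ∑ q with T q = T p, w q, w p ≤ N * t := by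
  set M : Θ → ℝ := fun θ => ∑ q with T q = θ, w q with hM
  have hM0 : ∀ θ, 0 ≤ M θ := fun θ => Finset.sum_nonneg fun q _ => hw q
  calc ∑ p ∈ B with w p < t * M (T p), w p
      ≤ ∑ p ∈ B with w p < t * M (T p), t * M (T p) :=
        Finset.sum_le_sum fun p hp => (Finset.mem_filter.1 hp).2.le
    _ ≤ ∑ p ∈ B, t * M (T p) :=
        Finset.sum_le_sum_of_subset_of_nonneg (Finset.filter_subset _ _)
          fun p _ _ => mul_nonneg ht (hM0 _)
    _ = ∑ θ ∈ Finset.univ.image T, ∑ p ∈ B with T p = θ, t * M (T p) :=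
        (Finset.sum_fiberwise_of_maps_to
          (fun p _ => Finset.mem_image_of_mem T (Finset.mem_univ p)) _).symm
    _ ≤ ∑ θ ∈ Finset.univ.image T, N * (t * M θ) := by
        refine Finset.sum_le_sum fun θ _ => ?_
        rw [Finset.sum_congr rfl fun p hp => by rw [(Finset.mem_filter.1 hp).2],
          Finset.sum_const, nsmul_eq_mul]
        exact mul_le_mul_of_nonneg_right (by exact_mod_cast hB θ) (mul_nonneg ht (hM0 θ))
    _ = N * t := by
        rw [← Finset.mul_sum, ← Finset.mul_sum, hM,
          Finset.sum_fiberwise_of_maps_to (fun p _ => Finset.mem_image_of_mem T (Finset.mem_univ p)),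
          hw1, mul_one]

theorem sum_noiseWeight_lt_hammingDist_le {ι : Type*} [Fintype ι] [DecidableEq ι] {δ τ : ℝ}
    (hδ : δ ∈ Set.Ioo (0 : ℝ) 1) {g : (ι → ZMod 2) → ι → ZMod 2}
    (hg : ∀ x, ∑ z with g z x ≠ z x, noiseWeight δ z ≤ τ) (D : ℕ) :
    ∑ z with D < hammingDist (g z) z, noiseWeight δ z ≤ Fintype.card ι * τ / (D + 1) := by
  rw [le_div_iff₀ (by positivity), Finset.sum_mul]
  calc ∑ z with D < hammingDist (g z) z, noiseWeight δ z * (D + 1)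
      ≤ ∑ z with D < hammingDist (g z) z, noiseWeight δ z * hammingDist (g z) z := by
        refine Finset.sum_le_sum fun z hz => ?_
        have : D + 1 ≤ hammingDist (g z) z := (Finset.mem_filter.1 hz).2
        exact mul_le_mul_of_nonneg_left (by exact_mod_cast this) (noiseWeight_pos hδ z).le
    _ ≤ ∑ z, noiseWeight δ z * hammingDist (g z) z :=
        Finset.sum_le_sum_of_subset_of_nonneg (Finset.filter_subset _ _)
          fun z _ _ => mul_nonneg (noiseWeight_pos hδ z).le (by positivity)
    _ = ∑ x, ∑ z with g z x ≠ z x, noiseWeight δ z := by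
        simp only [Finset.sum_filter]
        rw [Finset.sum_comm]
        refine Finset.sum_congr rfl fun z _ => ?_
        rw [← Finset.sum_filter, Finset.sum_const, nsmul_eq_mul, mul_comm]
        rfl
    _ ≤ ∑ _x : ι, τ := Finset.sum_le_sum fun x _ => hg x
    _ = Fintype.card ι * τ := by simp

theorem snd_sub_mem_rmCode {m r : ℕ} {p q : (Idx m → ZMod 2) × (Idx m → ZMod 2)}
    (hgt : Ugt m r p = Ugt m r q) (hY : Yf m p = Yf m q) : p.2 - q.2 ∈ rmCode m r := by
  have h : p.2 - q.2 = (Gmat m).mulVec (q.1 - p.1) := by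
    unfold Yf at hY
    rw [Matrix.mulVec_sub]
    linear_combination hY
  rw [h]
  refine Gmat_mulVec_mem_rmCode fun y hy => ?_
  exact sub_eq_zero.2 (congrFun hgt ⟨y, hy⟩).symm

theorem eq_of_snd_eq_of_Yf_eq {m : ℕ} {p q : (Idx m → ZMod 2) × (Idx m → ZMod 2)}
    (hz : p.2 = q.2) (hY : Yf m p = Yf m q) : p = q := by
  refine Prod.ext ?_ hz
  unfold Yf at hY
  rw [hz] at hY
  have := congrArg (Gmat m).mulVec (add_right_cancel hY)
  rwa [Gmat_mulVec_mulVec, Gmat_mulVec_mulVec] at this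

open Classical in
theorem sum_pairWeight_of_small_posterior_le {m r : ℕ} {δ τ t : ℝ} (hδ : δ ∈ Set.Ioo (0 : ℝ) 1)
    {g : (Idx m → ZMod 2) → Idx m → ZMod 2} (hgC : ∀ z, ∀ c ∈ rmCode m r, g (z + c) = g z)
    (hg : ∀ x, ∑ z with g z x ≠ z x, noiseWeight δ z ≤ τ) (D : ℕ) (ht : 0 ≤ t) :
    ∑ p₀ with pairWeight m δ p₀ <
        t * ∑ p with Ugt m r p = Ugt m r p₀ ∧ Yf m p = Yf m p₀, pairWeight m δ p,
      pairWeight m δ p₀ ≤ 2 ^ m * τ / (D + 1) + (2 ^ m + 1) ^ D * t := by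
  have hcard : Fintype.card (Idx m) = 2 ^ m := by simp [ZMod.card]
  set B : Finset ((Idx m → ZMod 2) × (Idx m → ZMod 2)) :=
    Finset.univ.filter fun p => hammingDist (g p.2) p.2 ≤ D with hB
  set T : (Idx m → ZMod 2) × (Idx m → ZMod 2) → _ := fun p => (Ugt m r p, Yf m p) with hT
  have hfiber : ∀ θ, (B.filter fun p => T p = θ).card ≤ (2 ^ m + 1) ^ D := by
    intro θ
    rcases (B.filter fun p => T p = θ).eq_empty_or_nonempty with h0 | ⟨q, hq⟩
    · simp [h0]
    have hqθ := (Finset.mem_filter.1 hq).2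
    rw [← hcard]
    refine le_trans ?_ (card_hammingDist_le (g q.2) D)
    have hTq : ∀ p ∈ B.filter fun p => T p = θ, Ugt m r p = Ugt m r q ∧ Yf m p = Yf m q := by
      intro p hp
      have := (Finset.mem_filter.1 hp).2.trans hqθ.symm
      exact Prod.ext_iff.1 this
    refine Finset.card_le_card_of_injOn Prod.snd (fun p hp => ?_) fun p hp p' hp' h => ?_
    · obtain ⟨h1, h2⟩ := hTq p hp
      have h3 := hgC q.2 _ (snd_sub_mem_rmCode h1 h2)
      rw [add_sub_cancel] at h3
      have h4 := (Finset.mem_filter.1 (Finset.mem_filter.1 hp).1).2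
      rw [h3] at h4
      simpa using h4
    · exact eq_of_snd_eq_of_Yf_eq h ((hTq p hp).2.trans (hTq p' hp').2.symm)
  have hlist := sum_weight_of_small_posterior_le (fun p => (pairWeight_pos hδ p).le)
    (sum_pairWeight m δ) T B hfiber ht
  have hfar := sum_noiseWeight_lt_hammingDist_le hδ hg D
  rw [← sum_pairWeight_snd, hcard] at hfar
  push_cast at hlist hfar
  simp only [hT, Prod.mk.injEq] at hlist
  refine le_trans ?_ (add_le_add hfar hlist)
  simp only [hB, Finset.sum_filter, ← Finset.sum_add_distrib]
  refine Finset.sum_le_sum fun p _ => ?_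
  have hp := pairWeight_pos hδ p
  by_cases hd : hammingDist (g p.2) p.2 ≤ D
  · simp only [hd, not_lt.2 hd, if_true, if_false, zero_add]
    rfl
  · simp only [hd, not_le.1 hd, if_true, if_false, add_zero]
    split_ifs <;> linarith

open Classical in
theorem one_sub_le_μUZ {m r : ℕ} {δ t b : ℝ} (hδ : δ ∈ Set.Ioo (0 : ℝ) 1) (ht : 0 < t)
    (h : ∑ p₀ with pairWeight m δ p₀ <
        t * ∑ p with Ugt m r p = Ugt m r p₀ ∧ Yf m p = Yf m p₀, pairWeight m δ p,
      pairWeight m δ p₀ ≤ b) :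
    1 - b ≤ ((μUZ m δ) {p₀ | ENNReal.ofReal t ≤ condP m r δ p₀ ∧
      (({a : {x : Idx m // wt x ≤ r} → ZMod 2 |
        condP m r δ p₀ < condPa m r δ a p₀}).ncard : ℝ) < t⁻¹}).toReal := by
  rw [μUZ_apply hδ, ENNReal.toReal_ofReal (Finset.sum_nonneg fun p _ => (pairWeight_pos hδ p).le)]
  have h1 := Finset.sum_filter_add_sum_filter_not Finset.univ (fun p₀ => pairWeight m δ p₀ <
        t * ∑ p with Ugt m r p = Ugt m r p₀ ∧ Yf m p = Yf m p₀, pairWeight m δ p)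
        (pairWeight m δ)
  rw [sum_pairWeight] at h1
  rw [← h1, sub_le_iff_le_add, add_comm]
  refine add_le_add ?_ h
  refine Finset.sum_le_sum_of_subset_of_nonneg (fun p hp => ?_)
    fun p _ _ => (pairWeight_pos hδ p).le
  rw [Finset.mem_filter] at hp ⊢
  have := ofReal_le_condP hδ (not_lt.1 hp.2)
  exact ⟨hp.1, this, ncard_lt_of_ofReal_le_condP ht this⟩

end ListDecoding

section Asymptotics

theorem eventually_linear_le_two_rpow_sqrt {b : ℝ} (hb : 0 < b) (K : ℝ) :
    ∀ᶠ m : ℕ in Filter.atTop, 2 * (m : ℝ) + K ≤ 2 ^ (b * √(m : ℝ)) := by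
  have hb' : 0 < Real.log 2 * b := mul_pos (Real.log_pos one_lt_two) hb
  have hsqrt : Filter.Tendsto (fun m : ℕ => √(m : ℝ)) Filter.atTop Filter.atTop :=
    Real.tendsto_sqrt_atTop.comp tendsto_natCast_atTop_atTop
  have h1 := hsqrt.eventually
    ((isLittleO_pow_exp_pos_mul_atTop 2 hb').bound (show (0 : ℝ) < 1 / 4 by norm_num))
  have h2 := ((Real.tendsto_exp_atTop.comp
    (Filter.tendsto_id.const_mul_atTop hb')).comp hsqrt).eventually_ge_atTop (2 * K)
  filter_upwards [h1, h2] with m h1 h2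
  rw [Real.norm_of_nonneg (by positivity), Real.norm_of_nonneg (by positivity),
    Real.sq_sqrt (by positivity)] at h1
  simp only [Function.comp_apply, id_eq] at h2
  rw [Real.rpow_def_of_pos two_pos, ← mul_assoc]
  linarith

theorem Hbin_mul_log_two (δ : ℝ) :
    Hbin δ * Real.log 2 = -(δ * Real.log δ + (1 - δ) * Real.log (1 - δ)) := by
  have h : Real.log 2 ≠ 0 := (Real.log_pos one_lt_two).ne'
  unfold Hbin Real.logb
  field_simp
  ring

/-- Shortening by `⌊a √m⌋` costs at most `a` in rate. -/
theorem binomLe_sub_floor_div_le {m r : ℕ} (hm : 0 < m) {a : ℝ} (ha0 : 0 ≤ a) (ha : a ≤ 1 / 2) :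
    ⌊a * √(m : ℝ)⌋₊ ≤ m ∧ (binomLe (m - ⌊a * √(m : ℝ)⌋₊) r : ℝ) / 2 ^ (m - ⌊a * √(m : ℝ)⌋₊)
      ≤ binomLe m r / 2 ^ m + a := by
  set k := ⌊a * √(m : ℝ)⌋₊ with hk
  have hm1 : (1 : ℝ) ≤ m := by exact_mod_cast hm
  have hs1 : 1 ≤ √(m : ℝ) := Real.one_le_sqrt.2 hm1
  have hsq : √(m : ℝ) * √(m : ℝ) = m := Real.mul_self_sqrt (by positivity)
  have hka : (k : ℝ) ≤ a * √(m : ℝ) := Nat.floor_le (by positivity)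
  have hkm : (k : ℝ) ≤ m / 2 := by nlinarith
  have hle : k ≤ m := by
    have : (k : ℝ) ≤ m := by linarith
    exact_mod_cast this
  refine ⟨hle, ?_⟩
  have hcast : ((m - k : ℕ) : ℝ) = m - k := Nat.cast_sub hle
  have hm' : 0 < m - k := by
    have : (0 : ℝ) < (m - k : ℕ) := by rw [hcast]; linarith
    exact_mod_cast this
  have h := binomLe_div_le_add hm' r k
  rw [Nat.sub_add_cancel hle] at h
  refine h.trans (add_le_add_right ?_ _)
  have hroot : √(m : ℝ) ≤ 2 * √((m - k : ℕ) : ℝ) := by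
    rw [Real.sqrt_le_left (by positivity), mul_pow, Real.sq_sqrt (by positivity), hcast]
    linarith
  rw [div_le_iff₀ (by linarith)]
  exact hka.trans (mul_le_mul_of_nonneg_left hroot ha0)

theorem far_probability_le {m k D : ℕ} (hkm : k ≤ m) {a s β E X : ℝ} (hβ : 0 < β)
    (hk : a * s < k + 1) (hE : E = 2 ^ ((m : ℝ) - a / 2 * s)) (hX : X = 2 ^ (a / 4 * s)) (hD : E < D + 1)
    (hXβ : 4 / β ^ 2 ≤ X) :
    2 ^ m * ((2 : ℝ) ^ (m - k) / 2 ^ m / β ^ 2) / (D + 1) ≤ X⁻¹ / 2 := by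
  have hX0 : 0 < X := hX ▸ by positivity
  have hE0 : 0 < E := hE ▸ by positivity
  have h1 : (2 : ℝ) ^ (m - k) * X ^ 2 ≤ 2 * E := by
    have h2 : (2 : ℝ) * E = 2 ^ (1 + ((m : ℝ) - a / 2 * s)) := by
      rw [Real.rpow_add two_pos, Real.rpow_one, hE]
    have h3 : (2 : ℝ) ^ (m - k) * X ^ 2 = 2 ^ (((m : ℝ) - k) + a / 2 * s) := by
      rw [Real.rpow_add two_pos, ← Nat.cast_sub hkm, Real.rpow_natCast, hX, ← Real.rpow_mul_natCast
        (by norm_num)]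
      congr 2
      push_cast
      ring
    rw [h2, h3]
    exact Real.rpow_le_rpow_of_exponent_le one_le_two (by linarith)
  have h4 : 4 ≤ X * β ^ 2 := (div_le_iff₀ (by positivity)).1 hXβ
  have h5 : 2 ^ m * ((2 : ℝ) ^ (m - k) / 2 ^ m / β ^ 2) / (D + 1)
      = 2 ^ (m - k) / (β ^ 2 * (D + 1)) := by
    field_simp
  have hP : (0 : ℝ) < 2 ^ (m - k) := by positivity
  have hD0 : (0 : ℝ) < D + 1 := by positivity
  rw [h5, inv_eq_one_div, div_div, div_le_div_iff₀ (by positivity) (by positivity)]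
  have h6 : (2 : ℝ) ^ (m - k) * X * 4 ≤ 2 * E * β ^ 2 := by
    calc (2 : ℝ) ^ (m - k) * X * 4 ≤ 2 ^ (m - k) * X * (X * β ^ 2) := by gcongr
      _ = 2 ^ (m - k) * X ^ 2 * β ^ 2 := by ring
      _ ≤ 2 * E * β ^ 2 := by gcongr
  have h7 : E * β ^ 2 ≤ (D + 1) * β ^ 2 := by gcongr
  linarith

theorem list_probability_le {m D : ℕ} (hm : 0 < m) {a E X : ℝ} (ha0 : 0 < a) (ha : a ≤ 1 / 2)
    (hE : E = 2 ^ ((m : ℝ) - a / 2 * √(m : ℝ))) (hX : X = 2 ^ (a / 4 * √(m : ℝ))) (hD : D ≤ E)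
    (hXm : 2 * (m : ℝ) + 2 ≤ X) :
    ((2 : ℝ) ^ m + 1) ^ D * 2 ^ (-((2 : ℝ) ^ ((m : ℝ) - a / 4 * √(m : ℝ)))) ≤ X⁻¹ / 2 := by
  have hm1 : (1 : ℝ) ≤ m := by exact_mod_cast hm
  have hs1 : 1 ≤ √(m : ℝ) := Real.one_le_sqrt.2 hm1
  have hsq : √(m : ℝ) * √(m : ℝ) = m := Real.mul_self_sqrt (by positivity)
  have hsm : √(m : ℝ) ≤ m := by nlinarith
  have hE1 : 1 ≤ E := hE ▸ Real.one_le_rpow one_le_two (by nlinarith)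
  have hEX : (2 : ℝ) ^ ((m : ℝ) - a / 4 * √(m : ℝ)) = E * X := by
    rw [hE, hX, ← Real.rpow_add two_pos]
    congr 1
    ring
  have h1 : ((2 : ℝ) ^ m + 1) ^ D ≤ 2 ^ (((m : ℝ) + 1) * E) := by
    calc ((2 : ℝ) ^ m + 1) ^ D ≤ (2 ^ (m + 1)) ^ D := by
          gcongr
          have : (1 : ℝ) ≤ 2 ^ m := one_le_pow₀ one_le_two
          rw [pow_succ]
          linarith
      _ = 2 ^ (((m : ℝ) + 1) * D) := by
          rw [Real.rpow_mul_natCast two_pos.le]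
          congr 1
          exact_mod_cast (Real.rpow_natCast 2 (m + 1)).symm
      _ ≤ 2 ^ (((m : ℝ) + 1) * E) :=
          Real.rpow_le_rpow_of_exponent_le one_le_two (by gcongr)
  have h2 : X⁻¹ / 2 = 2 ^ (-(a / 4 * √(m : ℝ)) - 1) := by
    rw [hX, ← Real.rpow_neg two_pos.le, Real.rpow_sub_one two_ne_zero]
  rw [h2, hEX]
  refine (mul_le_mul_of_nonneg_right h1 (by positivity)).trans ?_
  rw [← Real.rpow_add two_pos]
  refine Real.rpow_le_rpow_of_exponent_le one_le_two ?_
  have h3 : (2 * (m : ℝ) + 2) * E ≤ X * E := by gcongr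
  have h4 : a / 4 * √(m : ℝ) ≤ m := by nlinarith
  have h5 : (m : ℝ) + 1 ≤ (m + 1) * E := le_mul_of_one_le_right (by positivity) hE1
  linarith

end Asymptotics

/-- below capacity, with probability `≥ 1 - 2^{-c'√m}` over `(U, Y)`, the
conditional probability of the true value of `U_{≤ r_m}` given `(U_{> r_m}, Y)` is at
least `2^{-2^{m - c√m}}`; consequently fewer than `2^{2^{m-c√m}}` candidate values are
strictly more likely, i.e. the true codeword lies among the `2^{2^{m-c√m}}` most likely
candidates. -/
theorem stmt15 (δ : ℝ) (hδ : δ ∈ Set.Ioo 0 (1/2 : ℝ)) (rs : ℕ → ℕ)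
    (hrate : Filter.limsup (fun m : ℕ => (binomLe m (rs m) : ℝ) / 2 ^ m) Filter.atTop
      < 1 - Hbin δ) :
    ∃ c > (0 : ℝ), ∃ c' > (0 : ℝ), ∃ m₀ : ℕ, ∀ m ≥ m₀,
      (1 : ℝ) - (2 : ℝ) ^ (-(c' * Real.sqrt m)) ≤
        ((μUZ m δ) {p₀ |
          ENNReal.ofReal ((2 : ℝ) ^ (-((2 : ℝ) ^ ((m : ℝ) - c * Real.sqrt m))))
              ≤ condP m (rs m) δ p₀
          ∧ (({a : {x : Idx m // wt x ≤ rs m} → ZMod 2 |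
                condP m (rs m) δ p₀ < condPa m (rs m) δ a p₀}).ncard : ℝ)
              < (2 : ℝ) ^ ((2 : ℝ) ^ ((m : ℝ) - c * Real.sqrt m))}).toReal := by
  have hδ1 : δ ∈ Set.Ioo (0 : ℝ) 1 := ⟨hδ.1, by linarith [hδ.2]⟩
  have hlog : 0 < Real.log 2 := Real.log_pos one_lt_two
  obtain ⟨q, hq1, hq2⟩ := exists_between hrate
  have hbdd : Filter.IsBoundedUnder (· ≤ ·) Filter.atTop
      fun m : ℕ => (binomLe m (rs m) : ℝ) / 2 ^ m := by
    refine Filter.isBoundedUnder_of ⟨1, fun m => div_le_one_of_le₀ ?_ (by positivity)⟩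
    exact_mod_cast binomLe_le_two_pow m (rs m)
  have hev := Filter.eventually_lt_of_limsup_lt hq1 hbdd
  set ε := 1 - Hbin δ - q with hε
  have hε0 : 0 < ε := by linarith
  set a := min (ε / 2) (1 / 2) with ha
  have ha0 : 0 < a := lt_min (by linarith) (by norm_num)
  have haε : a ≤ ε / 2 := min_le_left _ _
  have ha2 : a ≤ 1 / 2 := min_le_right _ _
  set β := ε / 2 * Real.log 2 with hβ
  have hβ0 : 0 < β := by positivity
  have hgrow := eventually_linear_le_two_rpow_sqrt (show 0 < a / 4 by linarith) (2 + 4 / β ^ 2)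
  obtain ⟨m₀, hm₀⟩ := Filter.eventually_atTop.1
    ((hev.and hgrow).and (Filter.eventually_gt_atTop 0))
  refine ⟨a / 4, by linarith, a / 4, by linarith, m₀, fun m hm => ?_⟩
  obtain ⟨⟨hrm, hXm⟩, hmpos⟩ := hm₀ m hm
  obtain ⟨hkm, hrate'⟩ := binomLe_sub_floor_div_le (r := rs m) hmpos ha0.le ha2
  set k := ⌊a * √(m : ℝ)⌋₊ with hk
  have hβ' : β * 2 ^ (m - k) ≤ 2 ^ (m - k) * Real.log 2 - binomLe (m - k) (rs m) * Real.log 2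
      + 2 ^ (m - k) * (δ * Real.log δ + (1 - δ) * Real.log (1 - δ)) := by
    have h1 : (binomLe (m - k) (rs m) : ℝ) ≤ (1 - Hbin δ - ε / 2) * 2 ^ (m - k) := by
      rw [← div_le_iff₀ (by positivity)]
      linarith
    have h2 := mul_le_mul_of_nonneg_right h1 hlog.le
    rw [← neg_eq_iff_eq_neg.2 (Hbin_mul_log_two δ)]
    linear_combination h2
  obtain ⟨g, hgC, hg⟩ := exists_noise_estimator hδ hmpos (Nat.sub_le m k) hβ0 hβ'
  set E : ℝ := 2 ^ ((m : ℝ) - a / 2 * √(m : ℝ)) with hE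
  set X : ℝ := 2 ^ (a / 4 * √(m : ℝ)) with hX
  have hE0 : 0 ≤ E := by positivity
  have hβ4 : 0 < 4 / β ^ 2 := by positivity
  have hm0 : (0 : ℝ) ≤ m := Nat.cast_nonneg m
  have hsmall := sum_pairWeight_of_small_posterior_le hδ1 hgC hg ⌊E⌋₊
    (t := 2 ^ (-((2 : ℝ) ^ ((m : ℝ) - a / 4 * √(m : ℝ))))) (by positivity)
  have hfar := far_probability_le hkm hβ0 (Nat.lt_floor_add_one _) hE hX (Nat.lt_floor_add_one E)
    (by linarith)
  have hlist := list_probability_le hmpos ha0 ha2 hE hX (Nat.floor_le hE0) (by linarith)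
  have hmain := one_sub_le_μUZ hδ1 (by positivity) (hsmall.trans (add_le_add hfar hlist))
  rw [add_halves, hX, ← Real.rpow_neg two_pos.le, ← Real.rpow_neg two_pos.le, neg_neg] at hmain
  exact hmain
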